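/- For every fixed ε > 0 there exists a constant C = C(ε) > 0 such that for every odd prime p and all integers H, N with 0 ≤ H < H + N < p, one has |Q(H,N) − N · φ(p−1)/(p−1)| ≤ C · N^{3/4} · p^{1/8+ε}, where φ is Euler's totient function. -/

import Mathlib

section WeilAndFactorials

open Polynomial

section Stepanov

variable {𝔽 : Type*} [Field 𝔽]

theorem pow_sub_dvd_hasseDeriv_pow (F : 𝔽[X]) (n l : ℕ) :
    F ^ (n - l) ∣ hasseDeriv l (F ^ n) := by
  induction n generalizing l with
  | zero => simp
  | succ n ih =>
    rw [pow_succ', hasseDeriv_mul]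
    refine Finset.dvd_sum fun ij hij => ?_
    rw [Finset.HasAntidiagonal.mem_antidiagonal] at hij
    rcases Nat.eq_zero_or_pos ij.1 with h | h
    · rw [h, hasseDeriv_zero']
      have h2 : ij.2 = l := by omega
      rw [h2]
      refine (pow_dvd_pow F (show n + 1 - l ≤ (n - l) + 1 by omega)).trans ?_
      rw [pow_succ']
      exact mul_dvd_mul_left _ (ih l)
    · exact ((pow_dvd_pow F (by omega)).trans (ih ij.2)).mul_left _

theorem exists_hasseDeriv_pow_eq {F : 𝔽[X]} (hF : F ≠ 0) {n l : ℕ} (hl : l ≤ n) :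
    ∃ r : 𝔽[X], hasseDeriv l (F ^ n) = F ^ (n - l) * r ∧ r.natDegree ≤ l * F.natDegree := by
  obtain ⟨r, hr⟩ := pow_sub_dvd_hasseDeriv_pow F n l
  refine ⟨r, hr, ?_⟩
  rcases eq_or_ne r 0 with rfl | h0
  · simp
  have h1 := natDegree_hasseDeriv_le (F ^ n) l
  rw [hr, natDegree_mul (pow_ne_zero _ hF) h0, natDegree_pow, natDegree_pow] at h1
  obtain ⟨e, rfl⟩ := Nat.exists_eq_add_of_le hl
  simp only [Nat.add_sub_cancel_left, add_mul] at h1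
  omega

theorem exists_linearMap_hasseDeriv_pow_mul {F : 𝔽[X]} (hF : F ≠ 0) {n l : ℕ} (hl : l ≤ n) :
    ∃ R : 𝔽[X] →ₗ[𝔽] 𝔽[X], ∀ k, hasseDeriv l (F ^ n * k) = F ^ (n - l) * R k ∧
      (R k).natDegree ≤ l * F.natDegree + k.natDegree := by
  have H : ∀ i : ℕ, ∃ r : 𝔽[X], i ≤ l → hasseDeriv i (F ^ n) = F ^ (n - i) * r ∧
      r.natDegree ≤ i * F.natDegree := by
    intro i
    by_cases hi : i ≤ l
    · obtain ⟨r, hr⟩ := exists_hasseDeriv_pow_eq hF (hi.trans hl)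
      exact ⟨r, fun _ => hr⟩
    · exact ⟨0, fun h => absurd h hi⟩
  choose r hr using H
  refine ⟨∑ ij ∈ Finset.HasAntidiagonal.antidiagonal l,
    (LinearMap.mulLeft 𝔽 (r ij.1 * F ^ ij.2)).comp (hasseDeriv ij.2), fun k => ⟨?_, ?_⟩⟩
  · rw [hasseDeriv_mul, LinearMap.sum_apply, Finset.mul_sum]
    refine Finset.sum_congr rfl fun ij hij => ?_
    rw [Finset.HasAntidiagonal.mem_antidiagonal] at hij
    rw [(hr ij.1 (by omega)).1]
    have : n - ij.1 = (n - l) + ij.2 := by omega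
    rw [this, pow_add]
    simp only [LinearMap.comp_apply, LinearMap.mulLeft_apply]
    ring
  · rw [LinearMap.sum_apply]
    refine natDegree_sum_le_of_forall_le _ _ fun ij hij => ?_
    rw [Finset.HasAntidiagonal.mem_antidiagonal] at hij
    simp only [LinearMap.comp_apply, LinearMap.mulLeft_apply]
    refine natDegree_mul_le.trans (add_le_add (natDegree_mul_le.trans ?_)
      ((natDegree_hasseDeriv_le k ij.2).trans (Nat.sub_le _ _)))
    rw [← hij, add_mul]
    refine add_le_add (hr ij.1 (by omega)).2 ?_
    rw [natDegree_pow]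

theorem X_sub_C_pow_dvd_iff_hasseDeriv {P : 𝔽[X]} {α : 𝔽} {M : ℕ} :
    (X - C α) ^ M ∣ P ↔ ∀ l < M, (hasseDeriv l P).eval α = 0 := by
  rw [X_sub_C_pow_dvd_iff, X_pow_dvd_iff]
  simp_rw [← taylor_coeff]
  rfl

theorem mul_card_le_natDegree {P : 𝔽[X]} (hP : P ≠ 0) {M : ℕ} (Z : Finset 𝔽)
    (h : ∀ α ∈ Z, (X - C α) ^ M ∣ P) : M * Z.card ≤ P.natDegree := by
  have hd : ∏ α ∈ Z, (X - C α) ^ M ∣ P := by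
    refine Finset.prod_dvd_of_coprime (fun a _ b _ hab => ?_) h
    exact (pairwise_coprime_X_sub_C (s := id) Function.injective_id hab).pow
  have := natDegree_le_of_dvd hd hP
  rw [natDegree_prod _ _ fun α _ => pow_ne_zero _ (X_sub_C_ne_zero α)] at this
  simpa [mul_comm] using this

/-- Terms `a i * U i * X ^ e i` with `deg (a i) < g`, `U i` not vanishing at `0` and exponents
`e i` at distance at least `g` have distinct orders of vanishing at `0`, so they are independent. -/
theorem eq_zero_of_sum_mul_X_pow_eq_zero {ι : Type*} [Fintype ι] {g : ℕ}
    (a U : ι → 𝔽[X]) (e : ι → ℕ) (ha : ∀ i, a i ∈ degreeLT 𝔽 g)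
    (hU : ∀ i, (U i).eval 0 ≠ 0) (he : ∀ i j, i ≠ j → e i + g ≤ e j ∨ e j + g ≤ e i)
    (hsum : ∑ i, a i * U i * X ^ e i = 0) (i : ι) : a i = 0 := by
  classical
  by_contra hi
  obtain ⟨i₀, hi₀, hmin⟩ := Finset.exists_min_image (Finset.univ.filter fun i => a i ≠ 0) e
    ⟨i, by simpa using hi⟩
  simp only [Finset.mem_filter, Finset.mem_univ, true_and] at hi₀ hmin
  have h1 : X ^ (e i₀ + g) ∣ a i₀ * U i₀ * X ^ e i₀ := by
    rw [← Finset.add_sum_erase _ _ (Finset.mem_univ i₀)] at hsum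
    rw [eq_neg_of_add_eq_zero_left hsum, dvd_neg]
    refine Finset.dvd_sum fun j hj => ?_
    have hj := Finset.ne_of_mem_erase hj
    by_cases haj : a j = 0
    · simp [haj]
    · have h3 := hmin j haj
      rcases he i₀ j hj.symm with h | h
      · exact (pow_dvd_pow X h).mul_left _
      · rcases Nat.eq_zero_or_pos g with rfl | hg
        · exact (pow_dvd_pow X (by omega)).mul_left _
        · omega
  rw [pow_add, mul_comm (a i₀ * U i₀)] at h1
  have h2 := (mul_dvd_mul_iff_left (pow_ne_zero _ X_ne_zero)).1 h1
  have hc : IsCoprime (X ^ g : 𝔽[X]) (U i₀) := by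
    refine IsCoprime.pow_left ?_
    refine (irreducible_X.coprime_iff_not_dvd).2 fun h => hU i₀ ?_
    rw [X_dvd_iff, coeff_zero_eq_eval_zero] at h
    exact h
  have h3 := hc.dvd_of_dvd_mul_right h2
  exact hi₀ (eq_zero_of_dvd_of_degree_lt h3 (by simpa using mem_degreeLT.1 (ha i₀)))

theorem finrank_degreeLT (n : ℕ) : Module.finrank 𝔽 (degreeLT 𝔽 n) = n := by
  rw [(degreeLTEquiv 𝔽 n).finrank_eq, Module.finrank_fin_fun]

theorem finite_degreeLT (n : ℕ) : Module.Finite 𝔽 (degreeLT 𝔽 n) :=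
  Module.Finite.equiv (degreeLTEquiv 𝔽 n).symm

theorem mem_degreeLT_of_natDegree_lt {P : 𝔽[X]} {n : ℕ} (h : P.natDegree < n) :
    P ∈ degreeLT 𝔽 n :=
  mem_degreeLT.2 (degree_le_natDegree.trans_lt (by exact_mod_cast h))

theorem natDegree_lt_of_mem_degreeLT {P : 𝔽[X]} {n : ℕ} (hn : 0 < n) (h : P ∈ degreeLT 𝔽 n) :
    P.natDegree < n := by
  rcases eq_or_ne P 0 with rfl | h0
  · simpa
  · exact (natDegree_lt_iff_degree_lt h0).2 (mem_degreeLT.1 h)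

theorem stepanov_bound [Fintype 𝔽] [DecidableEq 𝔽] {F U : 𝔽[X]} (hFU : F = X * U)
    (hU : U.eval 0 ≠ 0) {g m M K : ℕ} (hq : g * m + 1 = Fintype.card 𝔽) (hg : 0 < g)
    (hM : M ≤ Fintype.card 𝔽)
    (hdim : M * (g + M * F.natDegree + K) < K * m * g) (c : 𝔽) :
    M * (Finset.univ.filter fun α : 𝔽 => (F.eval α) ^ g = c).card ≤
      M * F.natDegree + g + g * m * F.natDegree + Fintype.card 𝔽 * K := by
  classical
  set q := Fintype.card 𝔽 with hqdef
  set D := F.natDegree with hD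
  have hU0 : U ≠ 0 := by rintro rfl; simp at hU
  have hF : F ≠ 0 := by rw [hFU]; exact mul_ne_zero X_ne_zero hU0
  have H : ∀ (j : Fin m) (l : ℕ), ∃ R : 𝔽[X] →ₗ[𝔽] 𝔽[X], l < M → ∀ k,
      hasseDeriv l (F ^ (M + g * j) * k) = F ^ (M + g * j - l) * R k ∧
      (R k).natDegree ≤ l * F.natDegree + k.natDegree := by
    intro j l
    by_cases hl : l < M
    · obtain ⟨R, hR⟩ := exists_linearMap_hasseDeriv_pow_mul hF (n := M + g * j) (l := l) (by omega)
      exact ⟨R, fun _ => hR⟩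
    · exact ⟨0, fun h => absurd h hl⟩
  choose R hR using H
  -- the linear conditions on the coefficients of the auxiliary polynomial
  let Φ₀ : (Fin K × Fin m → degreeLT 𝔽 g) →ₗ[𝔽] (Fin M → 𝔽[X]) :=
    LinearMap.pi fun l => ∑ i : Fin K × Fin m,
      (LinearMap.mulLeft 𝔽 (C (c ^ (i.2 : ℕ)) * X ^ (i.1 : ℕ))).comp
        ((R i.2 l).comp ((degreeLT 𝔽 g).subtype.comp (LinearMap.proj i)))
  have hΦ₀ : ∀ a l, Φ₀ a l = ∑ i : Fin K × Fin m,
      C (c ^ (i.2 : ℕ)) * X ^ (i.1 : ℕ) * R i.2 l (a i : 𝔽[X]) := by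
    intro a l
    simp [Φ₀, LinearMap.pi_apply, LinearMap.sum_apply, mul_assoc]
  have hmem : ∀ a l, Φ₀ a l ∈ degreeLT 𝔽 (g + M * D + K) := by
    intro a l
    rw [hΦ₀]
    refine Submodule.sum_mem _ fun i _ => mem_degreeLT_of_natDegree_lt ?_
    have h1 := natDegree_lt_of_mem_degreeLT hg (a i).2
    have h2 := (hR i.2 l l.2 (a i)).2
    have h3 : (l : ℕ) * F.natDegree ≤ M * D := Nat.mul_le_mul_right _ l.2.le
    have h4 := i.1.2
    have h5 : (C (c ^ (i.2 : ℕ)) * X ^ (i.1 : ℕ) * R i.2 l (a i : 𝔽[X])).natDegree ≤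
        (i.1 : ℕ) + (R i.2 l (a i : 𝔽[X])).natDegree :=
      natDegree_mul_le.trans (add_le_add_left (natDegree_C_mul_X_pow_le _ _) _)
    omega
  let Φ : (Fin K × Fin m → degreeLT 𝔽 g) →ₗ[𝔽] (Fin M → degreeLT 𝔽 (g + M * D + K)) :=
    LinearMap.pi fun l => ((LinearMap.proj l).comp Φ₀).codRestrict _ fun a => hmem a l
  have := finite_degreeLT (𝔽 := 𝔽) g
  have := finite_degreeLT (𝔽 := 𝔽) (g + M * D + K)
  have hker : LinearMap.ker Φ ≠ ⊥ := by
    apply LinearMap.ker_ne_bot_of_finrank_lt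
    rw [Module.finrank_pi_fintype, Module.finrank_pi_fintype]
    simp only [finrank_degreeLT, Finset.sum_const, Finset.card_univ, Fintype.card_fin,
      Fintype.card_prod, smul_eq_mul]
    exact hdim
  obtain ⟨a, haker, ha0⟩ := Submodule.exists_mem_ne_zero_of_ne_bot hker
  have hΦa : ∀ l : Fin M, Φ₀ a l = 0 := by
    intro l
    have := congrFun (LinearMap.mem_ker.1 haker) l
    exact congrArg Subtype.val this
  -- the auxiliary polynomial
  set P₀ : 𝔽[X] := ∑ i : Fin K × Fin m, (a i : 𝔽[X]) * U ^ (g * (i.2 : ℕ)) *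
    X ^ (q * (i.1 : ℕ) + g * (i.2 : ℕ)) with hP₀
  have hP₀0 : P₀ ≠ 0 := by
    intro h
    apply ha0
    funext i
    refine Subtype.ext ?_
    refine eq_zero_of_sum_mul_X_pow_eq_zero (g := g) (fun i => (a i : 𝔽[X]))
      (fun i => U ^ (g * (i.2 : ℕ))) (fun i => q * (i.1 : ℕ) + g * (i.2 : ℕ)) (fun i => (a i).2)
      (fun i => ?_) ?_ h i
    · simpa using fun h => absurd h hU
    · have key : ∀ i j : Fin K × Fin m, i.1 < j.1 →
          q * (i.1 : ℕ) + g * (i.2 : ℕ) + g ≤ q * (j.1 : ℕ) + g * (j.2 : ℕ) := by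
        intro i j hij
        have h1 : q * ((i.1 : ℕ) + 1) ≤ q * (j.1 : ℕ) := Nat.mul_le_mul_left _ hij
        have h2 : g * ((i.2 : ℕ) + 1) ≤ g * m := Nat.mul_le_mul_left _ i.2.2
        rw [mul_add, mul_one] at h1 h2
        omega
      have key2 : ∀ i j : Fin K × Fin m, i.1 = j.1 → i.2 < j.2 →
          q * (i.1 : ℕ) + g * (i.2 : ℕ) + g ≤ q * (j.1 : ℕ) + g * (j.2 : ℕ) := by
        intro i j hij hij2
        have h2 : g * ((i.2 : ℕ) + 1) ≤ g * (j.2 : ℕ) := Nat.mul_le_mul_left _ hij2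
        rw [mul_add, mul_one] at h2
        rw [hij]
        omega
      intro i j hij
      rcases lt_trichotomy i.1 j.1 with h | h | h
      · exact Or.inl (key i j h)
      · rcases lt_trichotomy i.2 j.2 with h' | h' | h'
        · exact Or.inl (key2 i j h h')
        · exact absurd (Prod.ext h h') hij
        · exact Or.inr (key2 j i h.symm h')
      · exact Or.inr (key j i h)
  have hP₀' : P₀ = ∑ i : Fin K × Fin m, (a i : 𝔽[X]) * F ^ (g * (i.2 : ℕ)) * X ^ (q * (i.1 : ℕ)) := by
    rw [hP₀]
    refine Finset.sum_congr rfl fun i _ => ?_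
    rw [hFU, mul_pow, pow_add]
    ring
  have hP0 : F ^ M * P₀ ≠ 0 := mul_ne_zero (pow_ne_zero _ hF) hP₀0
  have hdeg : (F ^ M * P₀).natDegree ≤ M * D + g + g * m * D + q * K := by
    refine natDegree_mul_le.trans ?_
    rw [natDegree_pow, ← hD]
    have : P₀.natDegree ≤ g + g * m * D + q * K := by
      rw [hP₀']
      refine natDegree_sum_le_of_forall_le _ _ fun i _ => ?_
      refine natDegree_mul_le.trans (add_le_add (natDegree_mul_le.trans (add_le_add
        (natDegree_lt_of_mem_degreeLT hg (a i).2).le ?_)) ?_)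
      · rw [natDegree_pow]
        exact Nat.mul_le_mul_right _ (Nat.mul_le_mul_left _ i.2.2.le)
      · rw [natDegree_X_pow]
        exact Nat.mul_le_mul_left _ i.1.2.le
    omega
  refine (mul_card_le_natDegree hP0 _ fun α hα => ?_).trans hdeg
  rw [Finset.mem_filter] at hα
  have hα := hα.2
  set Q : 𝔽[X] := ∑ i : Fin K × Fin m, C (α ^ (i.1 : ℕ)) * (F ^ (M + g * (i.2 : ℕ)) * (a i : 𝔽[X]))
    with hQ
  have hPQ : (X - C α) ^ M ∣ F ^ M * P₀ - Q := by
    have : F ^ M * P₀ - Q = ∑ i : Fin K × Fin m, (a i : 𝔽[X]) * F ^ (M + g * (i.2 : ℕ)) *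
        ((X ^ q) ^ (i.1 : ℕ) - C α ^ (i.1 : ℕ)) := by
      rw [hP₀', hQ, Finset.mul_sum, ← Finset.sum_sub_distrib]
      refine Finset.sum_congr rfl fun i _ => ?_
      rw [C_pow, pow_add, ← pow_mul]
      ring
    rw [this]
    refine Finset.dvd_sum fun i _ => Dvd.dvd.mul_left ?_ _
    refine Dvd.dvd.trans ?_ (sub_dvd_pow_sub_pow _ _ _)
    have : (X ^ q - C α : 𝔽[X]) = (X - C α) ^ q := by
      rw [hqdef, ← FiniteField.expand_card (X - C α)]
      simp
    rw [this]
    exact pow_dvd_pow _ hM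
  have hQd : (X - C α) ^ M ∣ Q := by
    rw [X_sub_C_pow_dvd_iff_hasseDeriv]
    intro l hl
    have h0 := congrArg (eval α) (hΦa ⟨l, hl⟩)
    rw [hΦ₀, eval_finsetSum, eval_zero] at h0
    have : (hasseDeriv l Q).eval α = (F.eval α) ^ (M - l) * ∑ i : Fin K × Fin m,
        eval α (C (c ^ (i.2 : ℕ)) * X ^ (i.1 : ℕ) * R i.2 l (a i : 𝔽[X])) := by
      rw [hQ, map_sum, eval_finsetSum, Finset.mul_sum]
      refine Finset.sum_congr rfl fun i _ => ?_
      rw [← smul_eq_C_mul, map_smul, (hR i.2 l hl (a i)).1]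
      have h1 : M + g * (i.2 : ℕ) - l = (M - l) + g * (i.2 : ℕ) := by omega
      rw [h1, ← hα, pow_add, pow_mul]
      simp only [eval_smul, eval_mul, eval_pow, eval_C, eval_X, smul_eq_mul]
      ring
    rw [this, h0, mul_zero]
  have := dvd_add hPQ hQd
  rwa [sub_add_cancel] at this

end Stepanov

section MonicPolynomials

variable {k : Type*} [Field k] [Fintype k] [DecidableEq k]

/-- The monic polynomials of degree `n` over a finite field. -/
noncomputable def monicsOfDegree (k : Type*) [Field k] [Fintype k] [DecidableEq k] (n : ℕ) :
    Finset k[X] := by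
  classical exact Finset.univ.image fun c : Fin n → k => X ^ n + ∑ i, C (c i) * X ^ (i : ℕ)

theorem mem_monicsOfDegree {n : ℕ} {f : k[X]} :
    f ∈ monicsOfDegree k n ↔ f.Monic ∧ f.natDegree = n := by
  classical
  have hlt : ∀ c : Fin n → k, (∑ i, C (c i) * X ^ (i : ℕ)).degree < (n : WithBot ℕ) := by
    intro c
    refine (degree_sum_le _ _).trans_lt ((Finset.sup_lt_iff (WithBot.bot_lt_coe n)).2 fun i _ => ?_)
    exact (degree_C_mul_X_pow_le _ _).trans_lt (WithBot.coe_lt_coe.2 i.2)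
  simp only [monicsOfDegree, Finset.mem_image, Finset.mem_univ, true_and]
  constructor
  · rintro ⟨c, rfl⟩
    refine ⟨monic_X_pow_add (hlt c), ?_⟩
    rw [natDegree_add_eq_left_of_degree_lt (by simpa using hlt c), natDegree_X_pow]
  · rintro ⟨hf, rfl⟩
    refine ⟨fun i => f.coeff i, ?_⟩
    conv_rhs => rw [hf.as_sum]
    rw [← Fin.sum_univ_eq_sum_range (fun i => C (f.coeff i) * X ^ i)]

/-- The monic irreducible polynomials of degree at most `n` over a finite field. -/
noncomputable def monicIrreducibles (k : Type*) [Field k] [Fintype k] [DecidableEq k] (n : ℕ) :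
    Finset k[X] := by
  classical exact ((Finset.range (n + 1)).biUnion (monicsOfDegree k)).filter Irreducible

theorem mem_monicIrreducibles {n : ℕ} {P : k[X]} :
    P ∈ monicIrreducibles k n ↔ P.Monic ∧ P.natDegree ≤ n ∧ Irreducible P := by
  classical
  simp only [monicIrreducibles, Finset.mem_filter, Finset.mem_biUnion, Finset.mem_range,
    mem_monicsOfDegree]
  constructor
  · rintro ⟨⟨m, hm, h1, rfl⟩, h2⟩
    exact ⟨h1, by omega, h2⟩
  · rintro ⟨h1, h2, h3⟩
    exact ⟨⟨_, by omega, h1, rfl⟩, h3⟩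

open UniqueFactorizationMonoid Classical in
theorem natDegree_eq_sum_monicIrreducibles
    {f : k[X]} (hf : f.Monic) : f.natDegree = ∑ P ∈ monicIrreducibles k f.natDegree, ∑ j ∈ Finset.Icc 1 f.natDegree,
      if P ^ j ∣ f then P.natDegree else 0 := by
  classical
  have hmon : ∀ P ∈ normalizedFactors f, P.Monic := fun P hP => by
    have h1 := normalize_normalized_factor P hP
    rw [← h1]
    exact monic_normalize (irreducible_of_normalized_factor P hP).ne_zero
  have h1 : (normalizedFactors f).prod = f :=
    eq_of_monic_of_associated
      (by simpa using monic_multiset_prod_of_monic (normalizedFactors f) id hmon) hf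
      (prod_normalizedFactors hf.ne_zero)
  have h2 : f.natDegree = ((normalizedFactors f).map natDegree).sum := by
    conv_lhs => rw [← h1]
    exact natDegree_multiset_prod_of_monic _ hmon
  have h3 : ∀ P ∈ monicIrreducibles k f.natDegree, (∑ j ∈ Finset.Icc 1 f.natDegree,
      if P ^ j ∣ f then P.natDegree else 0) = (normalizedFactors f).count P • P.natDegree := by
    intro P hP
    rw [mem_monicIrreducibles] at hP
    obtain ⟨hP1, hP2, hP3⟩ := hP
    have hdvd : ∀ j : ℕ, P ^ j ∣ f ↔ j ≤ (normalizedFactors f).count P := by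
      intro j
      rw [dvd_iff_normalizedFactors_le_normalizedFactors (pow_ne_zero _ hP3.ne_zero) hf.ne_zero,
        normalizedFactors_pow, normalizedFactors_irreducible hP3, hP1.normalize_eq_self,
        Multiset.nsmul_singleton, ← Multiset.le_count_iff_replicate_le]
    have hle : (normalizedFactors f).count P ≤ f.natDegree := by
      have := natDegree_le_of_dvd ((hdvd _).2 le_rfl) hf.ne_zero
      rw [natDegree_pow] at this
      have := hP3.natDegree_pos
      nlinarith
    rw [← Finset.sum_filter, Finset.sum_const]
    congr 1
    have : (Finset.Icc 1 f.natDegree).filter (fun j => P ^ j ∣ f) =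
        Finset.Icc 1 ((normalizedFactors f).count P) := by
      ext j
      simp only [Finset.mem_filter, Finset.mem_Icc, hdvd]
      omega
    rw [this, Nat.card_Icc, Nat.add_sub_cancel]
  rw [Finset.sum_congr rfl h3]
  conv_lhs => rw [h2, Finset.sum_multiset_map_count]
  refine Finset.sum_subset (fun P hP => ?_) fun P _ hP => ?_
  · rw [Multiset.mem_toFinset] at hP
    exact mem_monicIrreducibles.2 ⟨hmon P hP,
      natDegree_le_of_dvd (dvd_of_mem_normalizedFactors hP) hf.ne_zero,
      irreducible_of_normalized_factor P hP⟩
  · rw [Multiset.mem_toFinset] at hP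
    rw [Multiset.count_eq_zero_of_notMem hP, zero_smul]

/-- The coefficients of the `L`-function of a function `Λ` on monic polynomials. -/
noncomputable def lCoeff (Λ : k[X] → ℂ) (n : ℕ) : ℂ := ∑ f ∈ monicsOfDegree k n, Λ f

/-- The coefficients of the logarithmic derivative of the Euler product attached to `Λ`. -/
noncomputable def primePowerSum (Λ : k[X] → ℂ) (s : ℕ) : ℂ :=
  ∑ P ∈ monicIrreducibles k s,
    if P.natDegree ∣ s then (P.natDegree : ℂ) * Λ P ^ (s / P.natDegree) else 0

omit [Fintype k] [DecidableEq k] in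
theorem map_pow_of_map_mul {Λ : k[X] → ℂ} (h1 : Λ 1 = 1)
    (hmul : ∀ f g : k[X], f.Monic → g.Monic → Λ (f * g) = Λ f * Λ g) {P : k[X]} (hP : P.Monic)
    (j : ℕ) : Λ (P ^ j) = Λ P ^ j := by
  induction j with
  | zero => simpa using h1
  | succ j ih => rw [pow_succ, hmul _ _ (hP.pow j) hP, ih, pow_succ]

open Classical in
theorem sum_monicsOfDegree_of_dvd {Λ : k[X] → ℂ}
    (hmul : ∀ f g : k[X], f.Monic → g.Monic → Λ (f * g) = Λ f * Λ g) {P : k[X]} (hP : P.Monic)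
    (n : ℕ) :
    (∑ f ∈ monicsOfDegree k n, if P ∣ f then Λ f else 0) =
      if P.natDegree ≤ n then Λ P * lCoeff Λ (n - P.natDegree) else 0 := by
  classical
  split_ifs with h
  · rw [lCoeff, Finset.mul_sum, ← Finset.sum_filter]
    symm
    refine Finset.sum_bij (fun f _ => P * f) (fun f hf => ?_) (fun f _ g _ hfg => ?_)
      (fun f hf => ?_) fun f hf => ?_
    · rw [mem_monicsOfDegree] at hf
      rw [Finset.mem_filter, mem_monicsOfDegree]
      refine ⟨⟨hP.mul hf.1, ?_⟩, dvd_mul_right _ _⟩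
      rw [hP.natDegree_mul hf.1, hf.2]
      omega
    · exact mul_left_cancel₀ hP.ne_zero hfg
    · rw [Finset.mem_filter, mem_monicsOfDegree] at hf
      obtain ⟨⟨hf1, hf2⟩, g, rfl⟩ := hf
      have hg : g.Monic := hP.of_mul_monic_left hf1
      refine ⟨g, mem_monicsOfDegree.2 ⟨hg, ?_⟩, rfl⟩
      rw [hP.natDegree_mul hg] at hf2
      omega
    · rw [mem_monicsOfDegree] at hf
      exact (hmul _ _ hP hf.1).symm
  · refine Finset.sum_eq_zero fun f hf => ?_
    rw [mem_monicsOfDegree] at hf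
    rw [if_neg]
    intro hd
    have := natDegree_le_of_dvd hd hf.1.ne_zero
    omega

theorem natCast_mul_lCoeff {Λ : k[X] → ℂ} (h1 : Λ 1 = 1)
    (hmul : ∀ f g : k[X], f.Monic → g.Monic → Λ (f * g) = Λ f * Λ g) (n : ℕ) :
    (n : ℂ) * lCoeff Λ n =
      ∑ s ∈ Finset.Icc 1 n, primePowerSum Λ s * lCoeff Λ (n - s) := by
  classical
  have hL : (n : ℂ) * lCoeff Λ n = ∑ P ∈ monicIrreducibles k n, ∑ j ∈ Finset.Icc 1 n,
      if j * P.natDegree ≤ n then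
        (P.natDegree : ℂ) * Λ P ^ j * lCoeff Λ (n - j * P.natDegree) else 0 := by
    have hf : ∀ f ∈ monicsOfDegree k n, (n : ℂ) * Λ f = ∑ P ∈ monicIrreducibles k n,
        ∑ j ∈ Finset.Icc 1 n, (P.natDegree : ℂ) * if P ^ j ∣ f then Λ f else 0 := by
      intro f hf
      rw [mem_monicsOfDegree] at hf
      have := natDegree_eq_sum_monicIrreducibles hf.1
      rw [hf.2] at this
      conv_lhs => rw [this]
      push_cast
      rw [Finset.sum_mul]
      refine Finset.sum_congr rfl fun P _ => ?_
      rw [Finset.sum_mul]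
      refine Finset.sum_congr rfl fun j _ => ?_
      split_ifs <;> simp
    rw [lCoeff, Finset.mul_sum, Finset.sum_congr rfl hf, Finset.sum_comm]
    refine Finset.sum_congr rfl fun P hP => ?_
    rw [mem_monicIrreducibles] at hP
    rw [Finset.sum_comm]
    refine Finset.sum_congr rfl fun j _ => ?_
    rw [← Finset.mul_sum, sum_monicsOfDegree_of_dvd hmul (hP.1.pow j), natDegree_pow,
      map_pow_of_map_mul h1 hmul hP.1]
    split_ifs <;> ring
  have hS : ∀ s ∈ Finset.Icc 1 n, primePowerSum Λ s = ∑ P ∈ monicIrreducibles k n,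
      if P.natDegree ∣ s then (P.natDegree : ℂ) * Λ P ^ (s / P.natDegree) else 0 := by
    intro s hs
    rw [Finset.mem_Icc] at hs
    refine Finset.sum_subset (fun P hP => ?_) fun P hP hP' => ?_
    · rw [mem_monicIrreducibles] at hP ⊢
      exact ⟨hP.1, by omega, hP.2.2⟩
    · rw [if_neg]
      intro hd
      rw [mem_monicIrreducibles] at hP hP'
      exact hP' ⟨hP.1, Nat.le_of_dvd (by omega) hd, hP.2.2⟩
  have hR : ∑ s ∈ Finset.Icc 1 n, primePowerSum Λ s * lCoeff Λ (n - s) =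
      ∑ s ∈ Finset.Icc 1 n, ∑ P ∈ monicIrreducibles k n, (if P.natDegree ∣ s then
        (P.natDegree : ℂ) * Λ P ^ (s / P.natDegree) else 0) * lCoeff Λ (n - s) :=
    Finset.sum_congr rfl fun s hs => by rw [hS s hs, Finset.sum_mul]
  rw [hR, Finset.sum_comm, hL]
  refine Finset.sum_congr rfl fun P hP => ?_
  rw [mem_monicIrreducibles] at hP
  have hpos := hP.2.2.natDegree_pos
  rw [← Finset.sum_filter]
  simp only [ite_mul, zero_mul]
  rw [← Finset.sum_filter]
  refine Finset.sum_bij (fun j _ => j * P.natDegree) (fun j hj => ?_) (fun i _ j _ hij => ?_)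
      (fun s hs => ?_) fun j hj => ?_
  · rw [Finset.mem_filter, Finset.mem_Icc] at hj ⊢
    exact ⟨⟨Nat.mul_pos hj.1.1 hpos, hj.2⟩, dvd_mul_left _ _⟩
  · exact Nat.eq_of_mul_eq_mul_right hpos hij
  · rw [Finset.mem_filter, Finset.mem_Icc] at hs
    obtain ⟨⟨h1, h2⟩, j, rfl⟩ := hs
    refine ⟨j, ?_, mul_comm _ _⟩
    rw [Finset.mem_filter, Finset.mem_Icc]
    refine ⟨⟨Nat.pos_of_ne_zero ?_, ?_⟩, by linarith [mul_comm j P.natDegree]⟩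
    · rintro rfl
      simp at h1
    · nlinarith
  · rw [Nat.mul_div_cancel _ hpos]

theorem sum_comp_minpoly {L : Type*} [Field L] [Fintype L] [Algebra k L] (Φ : k[X] → ℂ) :
    ∑ θ : L, Φ (minpoly k θ) = ∑ P ∈ monicIrreducibles k (Module.finrank k L),
      if P.natDegree ∣ Module.finrank k L then (P.natDegree : ℂ) * Φ P else 0 := by
  classical
  have hθint : ∀ θ : L, IsIntegral k θ := fun θ => Algebra.IsIntegral.isIntegral θ
  have hmaps : ∀ θ ∈ (Finset.univ : Finset L),
      minpoly k θ ∈ monicIrreducibles k (Module.finrank k L) := fun θ _ =>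
    mem_monicIrreducibles.2 ⟨minpoly.monic (hθint θ), minpoly.natDegree_le θ,
      minpoly.irreducible (hθint θ)⟩
  rw [← Finset.sum_fiberwise_of_maps_to hmaps]
  refine Finset.sum_congr rfl fun P hP => ?_
  rw [mem_monicIrreducibles] at hP
  obtain ⟨hP1, -, hP3⟩ := hP
  have hsum : ∑ θ ∈ Finset.univ.filter (fun θ : L => minpoly k θ = P), Φ (minpoly k θ) =
      (Finset.univ.filter (fun θ : L => minpoly k θ = P)).card * Φ P := by
    rw [Finset.sum_congr rfl fun θ hθ => by rw [(Finset.mem_filter.1 hθ).2], Finset.sum_const,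
      nsmul_eq_mul]
  rw [hsum]
  split_ifs with hd
  · congr 2
    have hcard : Nat.card k ^ Module.finrank k L = Fintype.card L := by
      rw [Nat.card_eq_fintype_card]
      exact (Module.card_eq_pow_finrank (K := k) (V := L)).symm
    have hdvd : P ∣ X ^ Fintype.card L - X := by
      rw [← hcard]
      exact hP3.natDegree_dvd_iff_dvd_X_pow_card_pow_sub_X.1 hd
    have hdvd' : P.map (algebraMap k L) ∣ X ^ Fintype.card L - X := by
      have := Polynomial.map_dvd (algebraMap k L) hdvd
      simpa using this
    have hne : (X ^ Fintype.card L - X : L[X]) ≠ 0 :=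
      FiniteField.X_pow_card_sub_X_ne_zero L Fintype.one_lt_card
    have hsplit0 : (X ^ Fintype.card L - X : L[X]).Splits :=
      splits_iff_card_roots.2 (by
        rw [FiniteField.roots_X_pow_card_sub_X,
          FiniteField.X_pow_card_sub_X_natDegree_eq L Fintype.one_lt_card]
        rfl)
    have hsplit : (P.map (algebraMap k L)).Splits := hsplit0.of_dvd hne hdvd'
    have hsep : P.Separable := PerfectField.separable_of_irreducible hP3
    have := card_rootSet_eq_natDegree hsep hsplit
    rw [← this, ← Set.toFinset_card]
    congr 1
    ext θ
    rw [Finset.mem_filter, Set.mem_toFinset, mem_rootSet]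
    constructor
    · rintro ⟨-, rfl⟩
      exact ⟨hP1.ne_zero, minpoly.aeval k θ⟩
    · rintro ⟨-, h⟩
      exact ⟨Finset.mem_univ _, (minpoly.eq_of_irreducible_of_monic hP3 h hP1).symm⟩
  · rw [Finset.filter_eq_empty_iff.2, Finset.card_empty, Nat.cast_zero, zero_mul]
    rintro θ - rfl
    exact hd (minpoly.degree_dvd (hθint θ))

end MonicPolynomials

section LogDerivative

/-- `A` is the logarithmic derivative `X * L' / L` of the polynomial `L`. -/
def IsLogDerivative (L : ℂ[X]) (A : PowerSeries ℂ) : Prop :=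
  ((X * derivative L : ℂ[X]) : PowerSeries ℂ) = A * (L : PowerSeries ℂ)

theorem isLogDerivative_of_coeff {L : ℂ[X]} {a : ℕ → ℂ} (ha : a 0 = 0)
    (h : ∀ n : ℕ, (n : ℂ) * L.coeff n = ∑ s ∈ Finset.Icc 1 n, a s * L.coeff (n - s)) :
    IsLogDerivative L (PowerSeries.mk a) := by
  ext n
  rw [Polynomial.coeff_coe, PowerSeries.coeff_mul,
    Finset.Nat.sum_antidiagonal_eq_sum_range_succ
      (fun i j => PowerSeries.coeff i (PowerSeries.mk a) * PowerSeries.coeff j (L : PowerSeries ℂ)) n]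
  simp only [PowerSeries.coeff_mk, Polynomial.coeff_coe]
  have h1 : Finset.range n.succ = insert 0 (Finset.Icc 1 n) := by
    ext i; simp only [Finset.mem_range, Finset.mem_insert, Finset.mem_Icc]; omega
  rw [h1, Finset.sum_insert (by simp), ha, zero_mul, zero_add, ← h n]
  cases n with
  | zero => simp
  | succ n => rw [coeff_X_mul, coeff_derivative]; push_cast; ring

theorem IsLogDerivative.prod {ι : Type*} (s : Finset ι) {L : ι → ℂ[X]} {A : ι → PowerSeries ℂ}
    (h : ∀ i, IsLogDerivative (L i) (A i)) :
    IsLogDerivative (∏ i ∈ s, L i) (∑ i ∈ s, A i) := by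
  classical
  induction s using Finset.induction_on with
  | empty => simp [IsLogDerivative]
  | insert i s hi ih =>
    have h1 := h i
    unfold IsLogDerivative at ih h1 ⊢
    rw [Finset.prod_insert hi, Finset.sum_insert hi, derivative_mul]
    push_cast at h1 ih ⊢
    linear_combination ((∏ i ∈ s, L i : ℂ[X]) : PowerSeries ℂ) * h1 + (L i : PowerSeries ℂ) * ih

theorem IsLogDerivative.eval {L : ℂ[X]} {a : ℕ → ℂ} (h : IsLogDerivative L (PowerSeries.mk a))
    {z : ℂ} (hz : Summable fun n => ‖a n * z ^ n‖) :
    z * (derivative L).eval z = (∑' n, a n * z ^ n) * L.eval z := by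
  have hpoly : ∀ P : ℂ[X], (Summable fun n => ‖P.coeff n * z ^ n‖) ∧
      ∑' n, P.coeff n * z ^ n = P.eval z := by
    intro P
    have h0 : ∀ n ∉ Finset.range (P.natDegree + 1), P.coeff n * z ^ n = 0 := by
      intro n hn
      rw [coeff_eq_zero_of_natDegree_lt (by simpa using hn), zero_mul]
    refine ⟨summable_of_ne_finset_zero (s := Finset.range (P.natDegree + 1)) fun n hn => ?_, ?_⟩
    · rw [h0 n hn, norm_zero]
    · rw [tsum_eq_sum h0, eval_eq_sum_range]
  obtain ⟨hs, ht⟩ := hpoly L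
  have h2 := (hpoly (X * derivative L)).2
  rw [eval_mul, eval_X] at h2
  rw [← h2, ← ht, tsum_mul_tsum_eq_tsum_sum_antidiagonal_of_summable_norm hz hs]
  refine tsum_congr fun n => ?_
  have h3 := congrArg (PowerSeries.coeff n) h
  rw [Polynomial.coeff_coe, PowerSeries.coeff_mul] at h3
  rw [h3, Finset.sum_mul]
  refine Finset.sum_congr rfl fun ij hij => ?_
  rw [Finset.HasAntidiagonal.mem_antidiagonal] at hij
  rw [PowerSeries.coeff_mk, Polynomial.coeff_coe, ← hij, pow_add]
  ring

theorem IsLogDerivative.one_le_mul_norm_of_isRoot {L : ℂ[X]} {a : ℕ → ℂ}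
    (h : IsLogDerivative L (PowerSeries.mk a)) (hL : L.eval 0 ≠ 0) {R B : ℝ} (hR : 0 < R)
    (ha : ∀ n, ‖a n‖ ≤ B * R ^ n) {z : ℂ} (hz : L.eval z = 0) : 1 ≤ R * ‖z‖ := by
  by_contra! hlt
  have hB : 0 ≤ B := by simpa using (norm_nonneg _).trans (ha 0)
  obtain ⟨r, hr1, hr2⟩ := exists_between (show ‖z‖ < R⁻¹ by
    rw [lt_inv_comm₀ (norm_nonneg z |>.lt_of_ne' ?_) hR]
    · rwa [← one_div, lt_div_iff₀ (norm_nonneg z |>.lt_of_ne' ?_)]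
      rw [norm_ne_zero_iff]; rintro rfl; exact hL hz
    · rw [norm_ne_zero_iff]; rintro rfl; exact hL hz)
  have hr0 : 0 ≤ r := (norm_nonneg z).trans hr1.le
  have hRr : R * r < 1 := by
    calc R * r < R * R⁻¹ := by gcongr
      _ = 1 := mul_inv_cancel₀ hR.ne'
  have hgeo : Summable fun n : ℕ => B * (R * r) ^ n :=
    (summable_geometric_of_lt_one (by positivity) hRr).mul_left B
  have hle : ∀ w : ℂ, ‖w‖ ≤ r → ∀ n, ‖a n * w ^ n‖ ≤ B * (R * r) ^ n := by
    intro w hw n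
    rw [norm_mul, norm_pow, mul_pow, ← mul_assoc]
    gcongr
    exact ha n
  have hsum : ∀ w : ℂ, ‖w‖ ≤ r → Summable fun n => ‖a n * w ^ n‖ := fun w hw =>
    Summable.of_nonneg_of_le (fun _ => norm_nonneg _) (hle w hw) hgeo
  set G : ℂ → ℂ := fun w => ∑' n, a n * w ^ n with hG
  have hGle : ∀ w : ℂ, ‖w‖ ≤ r → ‖G w‖ ≤ ∑' n, B * (R * r) ^ n := fun w hw =>
    (norm_tsum_le_tsum_norm (hsum w hw)).trans ((hsum w hw).tsum_le_tsum (hle w hw) hgeo)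
  have hL0 : L ≠ 0 := by rintro rfl; simp at hL
  have hz0 : z ≠ 0 := by rintro rfl; exact hL hz
  obtain ⟨N, hN, hNd⟩ := exists_eq_pow_rootMultiplicity_mul_and_not_dvd L hL0 z
  have he : 0 < rootMultiplicity z L := (rootMultiplicity_pos hL0).2 hz
  obtain ⟨e, he'⟩ := Nat.exists_eq_succ_of_ne_zero he.ne'
  rw [he'] at hN
  have hNz : N.eval z ≠ 0 := fun h0 => hNd (dvd_iff_isRoot.2 h0)
  have key : ∀ w : ℂ, ‖w‖ ≤ r → w ≠ z →
      w * ((e + 1) * N.eval w + (w - z) * (derivative N).eval w) = (w - z) * (G w * N.eval w) := by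
    intro w hw hwz
    have h1 := h.eval (hsum w hw)
    rw [hN, derivative_mul, derivative_X_sub_C_pow] at h1
    simp only [eval_add, eval_mul, eval_pow, eval_sub, eval_X, eval_C,
      Nat.succ_eq_add_one, Nat.add_sub_cancel, Nat.cast_add, Nat.cast_one] at h1
    have h2 : (w - z) ^ e ≠ 0 := pow_ne_zero _ (sub_ne_zero.2 hwz)
    apply mul_left_cancel₀ h2
    rw [pow_succ] at h1
    simp only [hG]
    linear_combination h1
  have hcont : Filter.Tendsto
      (fun w => w * ((e + 1) * N.eval w + (w - z) * (derivative N).eval w)) (nhdsWithin z {z}ᶜ)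
      (nhds (z * ((e + 1) * N.eval z + (z - z) * (derivative N).eval z))) := by
    apply Filter.Tendsto.mono_left _ nhdsWithin_le_nhds
    apply Continuous.tendsto
    fun_prop
  have hev : ∀ᶠ w in nhdsWithin z {z}ᶜ, ‖w‖ ≤ r ∧ w ≠ z := by
    refine Filter.Eventually.and (nhdsWithin_le_nhds ?_) self_mem_nhdsWithin
    exact (continuous_norm.tendsto z).eventually (ge_mem_nhds hr1)
  have hlim0 : Filter.Tendsto
      (fun w => w * ((e + 1) * N.eval w + (w - z) * (derivative N).eval w)) (nhdsWithin z {z}ᶜ)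
      (nhds 0) := by
    have hb : Filter.Tendsto (fun w : ℂ => ‖w - z‖ * ((∑' n, B * (R * r) ^ n) * ‖N.eval w‖))
        (nhdsWithin z {z}ᶜ) (nhds 0) := by
      have : Filter.Tendsto (fun w : ℂ => ‖w - z‖ * ((∑' n, B * (R * r) ^ n) * ‖N.eval w‖))
        (nhds z) (nhds (‖z - z‖ * ((∑' n, B * (R * r) ^ n) * ‖N.eval z‖))) := by
        apply Continuous.tendsto
        fun_prop
      rw [sub_self, norm_zero, zero_mul] at this
      exact this.mono_left nhdsWithin_le_nhds
    refine squeeze_zero_norm' ?_ hb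
    filter_upwards [hev] with w hw
    rw [key w hw.1 hw.2, norm_mul, norm_mul]
    gcongr
    exact hGle w hw.1
  have hne : (nhdsWithin z {z}ᶜ).NeBot := inferInstance
  have := tendsto_nhds_unique hcont hlim0
  rw [sub_self, zero_mul, add_zero] at this
  have h3 : (e + 1 : ℂ) ≠ 0 := Nat.cast_add_one_ne_zero e
  exact mul_ne_zero hz0 (mul_ne_zero h3 hNz) this

theorem norm_coeff_one_le_of_roots {L : ℂ[X]} (h0 : L.coeff 0 = 1) {R : ℝ} {d : ℕ} (hR : 0 < R)
    (hd : L.natDegree ≤ d) (h : ∀ z, L.eval z = 0 → 1 ≤ R * ‖z‖) : ‖L.coeff 1‖ ≤ d * R := by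
  have hL0 : L.eval 0 = 1 := by rw [← coeff_zero_eq_eval_zero, h0]
  have h1 := (IsAlgClosed.splits L).eval_derivative_div_eval_of_ne_zero
    (show L.eval 0 ≠ 0 by rw [hL0]; exact one_ne_zero)
  rw [hL0, div_one, ← coeff_zero_eq_eval_zero, coeff_derivative] at h1
  norm_num at h1
  rw [h1, norm_neg]
  have hL : L ≠ 0 := by rintro rfl; simp at h0
  refine (norm_multiset_sum_le (E := ℂ) _).trans ?_
  rw [Multiset.map_map]
  refine (Multiset.sum_le_card_nsmul _ R fun x hx => ?_).trans ?_
  · obtain ⟨z, hz, rfl⟩ := Multiset.mem_map.1 hx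
    have h2 := h z ((mem_roots hL).1 hz)
    have hz0 : 0 < ‖z‖ := by
      by_contra! h3
      nlinarith
    simp only [Function.comp_apply, norm_inv]
    rwa [inv_le_iff_one_le_mul₀ hz0]
  · rw [nsmul_eq_mul, Multiset.card_map]
    gcongr
    exact (card_roots' L).trans hd

end LogDerivative

section HybridWeight

variable {k : Type*} [Field k] 

/-- The completely multiplicative weight on monic polynomials attached to a multiplicative
character, an additive character, and a set of evaluation points. -/
noncomputable def hybridWeight (χ : MulChar k ℂ) (ψ : AddChar k ℂ) (T : Finset k) (f : k[X]) : ℂ :=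
  χ (∏ t ∈ T, f.eval t) * ψ f.nextCoeff

theorem hybridWeight_one (χ : MulChar k ℂ) (ψ : AddChar k ℂ) (T : Finset k) :
    hybridWeight χ ψ T 1 = 1 := by
  simp [hybridWeight, nextCoeff]

theorem hybridWeight_mul (χ : MulChar k ℂ) (ψ : AddChar k ℂ) (T : Finset k) (f g : k[X])
    (hf : f.Monic) (hg : g.Monic) :
    hybridWeight χ ψ T (f * g) = hybridWeight χ ψ T f * hybridWeight χ ψ T g := by
  simp only [hybridWeight, eval_mul, Finset.prod_mul_distrib, map_mul, hf.nextCoeff_mul hg,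
    AddChar.map_add_eq_mul]
  ring

variable [Fintype k] [DecidableEq k]

theorem lCoeff_zero (Λ : k[X] → ℂ) : lCoeff Λ 0 = Λ 1 := by
  have : monicsOfDegree k 0 = {1} := by
    ext f
    rw [mem_monicsOfDegree, Finset.mem_singleton]
    constructor
    · rintro ⟨hf, h0⟩
      exact hf.natDegree_eq_zero.1 h0
    · rintro rfl
      exact ⟨monic_one, natDegree_one⟩
  rw [lCoeff, this, Finset.sum_singleton]

theorem lCoeff_one (Λ : k[X] → ℂ) : lCoeff Λ 1 = ∑ x : k, Λ (X + C x) := by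
  rw [lCoeff]
  symm
  refine Finset.sum_bij (fun x _ => X + C x) ?_ ?_ ?_ ?_
  · intro x _
    exact mem_monicsOfDegree.2 ⟨monic_X_add_C x, natDegree_X_add_C x⟩
  · intro x _ y _ h
    simpa using h
  · intro f hf
    obtain ⟨h1, h2⟩ := mem_monicsOfDegree.1 hf
    exact ⟨f.coeff 0, Finset.mem_univ _, (h1.eq_X_add_C h2).symm⟩
  · intros; rfl

theorem lCoeff_hybridWeight_one (χ : MulChar k ℂ) (ψ : AddChar k ℂ) (T : Finset k) :
    lCoeff (hybridWeight χ ψ T) 1 = ∑ x : k, χ (∏ t ∈ T, (t + x)) * ψ x := by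
  rw [lCoeff_one]
  refine Finset.sum_congr rfl fun x _ => ?_
  simp [hybridWeight]

theorem lCoeff_hybridWeight_eq_zero {χ : MulChar k ℂ} (hχ : χ ≠ 1) (ψ : AddChar k ℂ)
    {T : Finset k} (h0 : 0 ∈ T) {n : ℕ} (hn : T.card < n) :
    lCoeff (hybridWeight χ ψ T) n = 0 := by
  set h : k[X] := Lagrange.basis T id 0 with hh
  have hinj : Set.InjOn (id : k → k) T := Function.injective_id.injOn
  have hdeg : h.degree = ((T.card - 1 : ℕ) : WithBot ℕ) := Lagrange.degree_basis hinj h0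
  have hnat : h.natDegree = T.card - 1 := natDegree_eq_of_degree_eq_some hdeg
  have hT : 0 < T.card := Finset.card_pos.2 ⟨0, h0⟩
  have he0 : h.eval 0 = 1 := by
    have := Lagrange.eval_basis_self hinj h0
    simpa using this
  have he : ∀ t ∈ T, t ≠ 0 → h.eval t = 0 := by
    intro t ht ht0
    have := Lagrange.eval_basis_of_ne (v := (id : k → k)) (Ne.symm ht0) ht
    simpa using this
  have hcdeg : ∀ c : k, (C c * h).natDegree + 1 < n := by
    intro c
    have := natDegree_C_mul_le c h
    omega
  have hmem : ∀ c : k, ∀ f ∈ monicsOfDegree k n, f + C c * h ∈ monicsOfDegree k n := by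
    intro c f hf
    obtain ⟨h1, h2⟩ := mem_monicsOfDegree.1 hf
    have hlt : (C c * h).natDegree < f.natDegree := by have := hcdeg c; omega
    have hlt' : (C c * h).degree < f.degree := degree_lt_degree hlt
    exact mem_monicsOfDegree.2 ⟨h1.add_of_left hlt',
      by rw [natDegree_add_eq_left_of_natDegree_lt hlt, h2]⟩
  have hshift : ∀ c : k, lCoeff (hybridWeight χ ψ T) n =
      ∑ f ∈ monicsOfDegree k n, hybridWeight χ ψ T (f + C c * h) := by
    intro c
    rw [lCoeff]
    refine Finset.sum_bij' (fun f _ => f + C (-c) * h) (fun f _ => f + C c * h) ?_ ?_ ?_ ?_ ?_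
    · exact hmem (-c)
    · exact hmem c
    · intro f _; simp
    · intro f _; simp
    · intro f _; simp
  have hnext : ∀ c : k, ∀ f ∈ monicsOfDegree k n, (f + C c * h).nextCoeff = f.nextCoeff := by
    intro c f hf
    have h2 := (mem_monicsOfDegree.1 hf).2
    have h3 := (mem_monicsOfDegree.1 (hmem c f hf)).2
    rw [nextCoeff_of_natDegree_pos (by omega), nextCoeff_of_natDegree_pos (by omega), h2, h3,
      coeff_add, coeff_eq_zero_of_natDegree_lt (p := C c * h) (by have := hcdeg c; omega), add_zero]
  have hval : ∀ c : k, ∀ f ∈ monicsOfDegree k n, hybridWeight χ ψ T (f + C c * h) =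
      χ (f.eval 0 + c) * (χ (∏ t ∈ T.erase 0, f.eval t) * ψ f.nextCoeff) := by
    intro c f hf
    rw [hybridWeight, hnext c f hf, ← Finset.mul_prod_erase _ _ h0, map_mul, mul_assoc]
    rw [Finset.prod_congr rfl fun t ht => show (f + C c * h).eval t = f.eval t by
      simp [he t (Finset.mem_of_mem_erase ht) (Finset.ne_of_mem_erase ht)]]
    simp [he0]
  have hsum : (Fintype.card k : ℂ) * lCoeff (hybridWeight χ ψ T) n = 0 := by
    have : (Fintype.card k : ℂ) * lCoeff (hybridWeight χ ψ T) n =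
        ∑ c : k, lCoeff (hybridWeight χ ψ T) n := by simp
    rw [this, Finset.sum_congr rfl fun c _ => hshift c, Finset.sum_comm]
    refine Finset.sum_eq_zero fun f hf => ?_
    have hadd : ∑ c, χ (f.eval 0 + c) = ∑ c, χ c :=
      Equiv.sum_comp (Equiv.addLeft (f.eval 0)) (fun c => χ c)
    rw [Finset.sum_congr rfl fun c _ => hval c f hf, ← Finset.sum_mul,
      hadd, MulChar.sum_eq_zero_of_ne_one hχ, zero_mul]
  have hk : (Fintype.card k : ℂ) ≠ 0 := Nat.cast_ne_zero.2 Fintype.card_ne_zero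
  exact (mul_eq_zero.1 hsum).resolve_left hk

end HybridWeight

section NormTrace

variable {k L : Type*} [Field k] [Field L] [Algebra k L] [FiniteDimensional k L]

theorem norm_algebraMap_sub_eq_eval_minpoly_pow (θ : L) (t : k) :
    Algebra.norm k (algebraMap k L t - θ) =
      (minpoly k θ).eval t ^ (Module.finrank k L / (minpoly k θ).natDegree) := by
  have hθint : IsIntegral k θ := Algebra.IsIntegral.isIntegral θ
  let pb := IntermediateField.adjoin.powerBasis hθint
  have hdeg : Module.finrank k (IntermediateField.adjoin k {θ}) = (minpoly k θ).natDegree :=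
    IntermediateField.adjoin.finrank hθint
  have hmul := Module.finrank_mul_finrank k (IntermediateField.adjoin k {θ}) L
  have hpos : 0 < (minpoly k θ).natDegree := minpoly.natDegree_pos hθint
  have hdiv : Module.finrank k L / (minpoly k θ).natDegree =
      Module.finrank (IntermediateField.adjoin k {θ}) L := by
    rw [← hmul, hdeg, Nat.mul_div_cancel_left _ hpos]
  have hgen : algebraMap (IntermediateField.adjoin k {θ}) L
      (algebraMap k _ t - IntermediateField.AdjoinSimple.gen k θ) = algebraMap k L t - θ := by
    rw [map_sub, IntermediateField.AdjoinSimple.algebraMap_gen,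
      ← IsScalarTower.algebraMap_apply]
  have hnorm : Algebra.norm k (algebraMap k (IntermediateField.adjoin k {θ}) t -
      IntermediateField.AdjoinSimple.gen k θ) = (minpoly k θ).eval t := by
    have hg : pb.gen = IntermediateField.AdjoinSimple.gen k θ :=
      IntermediateField.adjoin.powerBasis_gen hθint
    have h1 := charpoly_leftMulMatrix pb
    rw [hg, Algebra.leftMulMatrix_apply, LinearMap.charpoly_toMatrix,
      IntermediateField.minpoly_gen] at h1
    rw [← h1, LinearMap.eval_charpoly, Algebra.norm_apply]
    congr 1
    ext x
    simp [Algebra.algebraMap_eq_smul_one]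
  rw [← hgen, ← Algebra.norm_norm (S := IntermediateField.adjoin k {θ}), Algebra.norm_algebraMap,
    map_pow, hnorm, hdiv]

theorem trace_neg_eq_mul_nextCoeff_minpoly (θ : L) :
    Algebra.trace k L (-θ) =
      (Module.finrank k L / (minpoly k θ).natDegree : ℕ) * (minpoly k θ).nextCoeff := by
  have hθint : IsIntegral k θ := Algebra.IsIntegral.isIntegral θ
  have hdeg : Module.finrank k (IntermediateField.adjoin k {θ}) = (minpoly k θ).natDegree :=
    IntermediateField.adjoin.finrank hθint
  have hmul := Module.finrank_mul_finrank k (IntermediateField.adjoin k {θ}) L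
  have hpos : 0 < (minpoly k θ).natDegree := minpoly.natDegree_pos hθint
  have hdiv : Module.finrank k L / (minpoly k θ).natDegree =
      Module.finrank (IntermediateField.adjoin k {θ}) L := by
    rw [← hmul, hdeg, Nat.mul_div_cancel_left _ hpos]
  rw [hdiv, map_neg, trace_eq_finrank_mul_minpoly_nextCoeff]
  ring

/-- The value of the hybrid weight at a minimal polynomial, in terms of norm and trace. -/
theorem hybridWeight_minpoly_pow (χ : MulChar k ℂ) (ψ : AddChar k ℂ) (T : Finset k) (θ : L) :
    hybridWeight χ ψ T (minpoly k θ) ^ (Module.finrank k L / (minpoly k θ).natDegree) =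
      χ (Algebra.norm k (∏ t ∈ T, (algebraMap k L t - θ))) * ψ (Algebra.trace k L (-θ)) := by
  rw [hybridWeight, mul_pow, ← map_pow χ, ← Finset.prod_pow, trace_neg_eq_mul_nextCoeff_minpoly, ← nsmul_eq_mul, AddChar.map_nsmul_eq_pow]
  simp only [map_prod, norm_algebraMap_sub_eq_eval_minpoly_pow]

end NormTrace

theorem primePowerSum_hybridWeight {k L : Type*} [Field k] [Fintype k] [DecidableEq k] [Field L]
    [Fintype L] [Algebra k L] (χ : MulChar k ℂ) (ψ : AddChar k ℂ) (T : Finset k) :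
    primePowerSum (hybridWeight χ ψ T) (Module.finrank k L) =
      ∑ θ : L, χ (Algebra.norm k (∏ t ∈ T, (algebraMap k L t - θ))) *
        ψ (Algebra.trace k L (-θ)) := by
  rw [← Finset.sum_congr rfl fun θ _ => hybridWeight_minpoly_pow χ ψ T θ,
    sum_comp_minpoly (k := k)
      (fun P => hybridWeight χ ψ T P ^ (Module.finrank k L / P.natDegree))]
  rfl

section ArtinSchreier

variable {k L : Type*} [Field k] [Fintype k] [Field L] [Fintype L] [Algebra k L]

variable (k L) in
/-- The Artin–Schreier map `z ↦ z ^ |k| - z`. -/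
noncomputable def artinSchreier : L →ₗ[k] L :=
  (FiniteField.frobeniusAlgEquivOfAlgebraic k L).toLinearMap - LinearMap.id

theorem artinSchreier_apply (z : L) : artinSchreier k L z = z ^ Fintype.card k - z := by
  simp [artinSchreier]

theorem finrank_ker_artinSchreier_le : Module.finrank k (artinSchreier k L).ker ≤ 1 := by
  classical
  have hcard : Fintype.card (artinSchreier k L).ker ≤ Fintype.card k := by
    have hk := Fintype.one_lt_card (α := k)
    have hne : (X ^ Fintype.card k - X : L[X]) ≠ 0 := FiniteField.X_pow_card_sub_X_ne_zero L hk
    have hle : Fintype.card (artinSchreier k L).ker ≤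
        (X ^ Fintype.card k - X : L[X]).roots.toFinset.card := by
      rw [← Fintype.card_coe]
      refine Fintype.card_le_of_injective (fun z => ⟨z.1, ?_⟩) ?_
      · rw [Multiset.mem_toFinset, mem_roots hne]
        have := z.2
        rw [LinearMap.mem_ker, artinSchreier_apply] at this
        simpa using this
      · intro a b h
        exact Subtype.ext (congrArg (fun x => x.1) h)
    refine hle.trans ((Multiset.toFinset_card_le _).trans ((card_roots' _).trans ?_))
    rw [FiniteField.X_pow_card_sub_X_natDegree_eq L hk]
  have h := Module.card_eq_pow_finrank (K := k) (V := (artinSchreier k L).ker)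
  rw [h] at hcard
  exact (Nat.pow_le_pow_iff_right (Fintype.one_lt_card (α := k))).1 (by simpa using hcard)

theorem range_artinSchreier_le : (artinSchreier k L).range ≤ (Algebra.trace k L).ker := by
  rintro _ ⟨z, rfl⟩
  rw [LinearMap.mem_ker]
  have := Algebra.trace_eq_of_algEquiv (FiniteField.frobeniusAlgEquivOfAlgebraic k L) z
  simp only [artinSchreier, LinearMap.sub_apply, map_sub]
  simpa [sub_eq_zero] using this

theorem range_artinSchreier_and_finrank_ker :
    (artinSchreier k L).range = (Algebra.trace k L).ker ∧
      Module.finrank k (artinSchreier k L).ker = 1 := by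
  have h1 := LinearMap.finrank_range_add_finrank_ker (artinSchreier k L)
  have h2 := LinearMap.finrank_range_add_finrank_ker (Algebra.trace k L)
  rw [LinearMap.range_eq_top.2 (Algebra.trace_surjective k L), finrank_top,
    Module.finrank_self] at h2
  have h3 := finrank_ker_artinSchreier_le (k := k) (L := L)
  have h4 := Submodule.finrank_mono (range_artinSchreier_le (k := k) (L := L))
  exact ⟨Submodule.eq_of_le_of_finrank_le range_artinSchreier_le (by omega), by omega⟩

theorem card_fiber_artinSchreier [DecidableEq L] {θ : L} (hθ : Algebra.trace k L θ = 0) :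
    (Finset.univ.filter fun z => artinSchreier k L z = θ).card = Fintype.card k := by
  classical
  obtain ⟨hr, hk⟩ := range_artinSchreier_and_finrank_ker (k := k) (L := L)
  have hmem : θ ∈ (artinSchreier k L).range := by rw [hr]; exact hθ
  obtain ⟨z₀, rfl⟩ := hmem
  have h := Module.card_eq_pow_finrank (K := k) (V := (artinSchreier k L).ker)
  rw [hk, pow_one] at h
  rw [← h, ← Fintype.card_coe]
  refine Fintype.card_congr ⟨fun z => ⟨z.1 - z₀, ?_⟩, fun z => ⟨z.1 + z₀, ?_⟩, ?_, ?_⟩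
  · have := (Finset.mem_filter.1 z.2).2
    rw [LinearMap.mem_ker, map_sub, this, sub_self]
  · rw [Finset.mem_filter, map_add, LinearMap.mem_ker.1 z.2, zero_add]
    exact ⟨Finset.mem_univ _, rfl⟩
  · intro z; simp
  · intro z; simp

theorem sum_comp_artinSchreier (G : L → ℂ) :
    ∑ z : L, G (artinSchreier k L z) =
      ∑ ψ : AddChar k ℂ, ∑ θ : L, G θ * ψ (Algebra.trace k L (-θ)) := by
  classical
  rw [Finset.sum_comm]
  simp only [← Finset.mul_sum, AddChar.sum_apply_eq_ite]
  rw [← Finset.sum_fiberwise (s := Finset.univ) (g := artinSchreier k L)]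
  refine Finset.sum_congr rfl fun θ _ => ?_
  rw [Finset.sum_congr rfl fun z hz => by rw [(Finset.mem_filter.1 hz).2], Finset.sum_const,
    nsmul_eq_mul, map_neg, neg_eq_zero]
  split_ifs with h
  · rw [card_fiber_artinSchreier h, mul_comm]
  · rw [mul_zero, Finset.card_eq_zero.2, Nat.cast_zero, zero_mul]
    refine Finset.filter_eq_empty_iff.2 fun {z} _ hz => h ?_
    rw [← hz]
    exact range_artinSchreier_le ⟨z, rfl⟩

/-- The polynomial `∏ (t - (X ^ |k| - X))`. -/
noncomputable def artinSchreierProduct (L : Type*) [Field L] [Algebra k L] (T : Finset k) : L[X] :=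
  ∏ t ∈ T, (C (algebraMap k L t) - (X ^ Fintype.card k - X))

theorem sum_primePowerSum_hybridWeight [DecidableEq k] (χ : MulChar k ℂ) (T : Finset k) :
    ∑ ψ : AddChar k ℂ, primePowerSum (hybridWeight χ ψ T) (Module.finrank k L) =
      ∑ z : L, χ (Algebra.norm k ((artinSchreierProduct L T).eval z)) := by
  simp only [primePowerSum_hybridWeight (L := L)]
  rw [← sum_comp_artinSchreier (k := k)
    fun θ => χ (Algebra.norm k (∏ t ∈ T, (algebraMap k L t - θ)))]
  simp [artinSchreierProduct, eval_prod, artinSchreier_apply]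

omit [Fintype L] in
theorem natDegree_artinSchreierProduct (T : Finset k) :
    (artinSchreierProduct L T).natDegree = T.card * Fintype.card k := by
  have hk := Fintype.one_lt_card (α := k)
  have hd : ∀ t : k, (C (algebraMap k L t) - (X ^ Fintype.card k - X)).natDegree =
      Fintype.card k := by
    intro t
    rw [natDegree_sub_eq_right_of_natDegree_lt, FiniteField.X_pow_card_sub_X_natDegree_eq L hk]
    rw [FiniteField.X_pow_card_sub_X_natDegree_eq L hk, natDegree_C]
    omega
  rw [artinSchreierProduct, natDegree_prod]
  · simp [hd]
  · intro t _ h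
    have := hd t
    rw [h, natDegree_zero] at this
    omega

omit [Fintype L] in
theorem exists_artinSchreierProduct_eq_X_mul [DecidableEq k] {T : Finset k} (h0 : 0 ∈ T) :
    ∃ U : L[X], artinSchreierProduct L T = X * U ∧ U.eval 0 ≠ 0 := by
  have hk := Fintype.one_lt_card (α := k)
  refine ⟨(1 - X ^ (Fintype.card k - 1)) *
    ∏ t ∈ T.erase 0, (C (algebraMap k L t) - (X ^ Fintype.card k - X)), ?_, ?_⟩
  · rw [artinSchreierProduct, ← Finset.mul_prod_erase _ _ h0, ← mul_assoc]
    congr 1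
    obtain ⟨n, hn⟩ : ∃ n, Fintype.card k = n + 1 := ⟨_, (Nat.sub_add_cancel hk.le).symm⟩
    rw [hn, map_zero, C_0, Nat.add_sub_cancel]
    ring
  · have h1 : Fintype.card k - 1 ≠ 0 := by omega
    have h2 : Fintype.card k ≠ 0 := by omega
    simp only [eval_mul, eval_sub, eval_one, eval_pow, eval_X, eval_prod, eval_C,
      zero_pow h1, zero_pow h2, sub_zero, one_mul]
    refine Finset.prod_ne_zero_iff.2 fun t ht => ?_
    simpa using Finset.ne_of_mem_erase ht

end ArtinSchreier

section StepanovParameters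

theorem stepanov_parameters {m g d M q E K : ℕ} (hm : 2 ≤ m) (hq : g * m + 1 = q)
    (hM : M * M ≤ q) (hE : E = (m + 1) * (d + 1) + 1) (hM0 : 2 * E + 2 * m ≤ M)
    (hK : K = (M + E) / m + 1) : M * (g + M * d + K) < K * m * g ∧ m * K ≤ M + E + m := by
  have h1 : M + E < m * K := by
    rw [hK]
    exact Nat.lt_mul_div_succ _ (by omega)
  have h2 : m * K ≤ M + E + m := by
    rw [hK, mul_add, mul_one]
    have := Nat.mul_div_le (M + E) m
    omega
  refine ⟨?_, h2⟩
  have hKM : K ≤ M := by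
    by_contra! h
    have : 2 * K ≤ m * K := Nat.mul_le_mul_right _ hm
    omega
  have hMpos : 0 < M := by omega
  have hg : 0 < g := by
    rcases Nat.eq_zero_or_pos g with rfl | h
    · exfalso
      have : M * 1 ≤ M * M := Nat.mul_le_mul_left _ hMpos
      omega
    · exact h
  have h3 : M * K ≤ q := (Nat.mul_le_mul_left _ hKM).trans hM
  have h4 : M * M * d ≤ q * d := Nat.mul_le_mul_right _ hM
  have h5 : q * (d + 1) ≤ g * ((m + 1) * (d + 1)) := by
    rw [← hq]
    nlinarith [Nat.zero_le (d + 1)]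
  have h6 : g * (M + E + 1) ≤ g * (m * K) := Nat.mul_le_mul_left _ h1
  rw [hE] at h6
  nlinarith

theorem sum_abs_le_of_le_of_sum_ge {ι : Type*} (s : Finset ι) (a : ι → ℝ) {B : ℝ} (hB : 0 ≤ B)
    (h : ∀ i ∈ s, a i ≤ B) (hs : -B ≤ ∑ i ∈ s, a i) :
    ∑ i ∈ s, |a i| ≤ (2 * s.card + 1) * B := by
  have : ∑ i ∈ s, |a i| ≤ ∑ i ∈ s, (2 * B - a i) := by
    refine Finset.sum_le_sum fun i hi => ?_
    have := h i hi
    rw [abs_le]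
    constructor <;> linarith
  rw [Finset.sum_sub_distrib, Finset.sum_const, nsmul_eq_mul] at this
  linarith

theorem norm_mulChar_apply_eq_one {R : Type*} [CommRing R] [Finite R] (χ : MulChar R ℂ) {a : R}
    (ha : IsUnit a) : ‖χ a‖ = 1 := by
  obtain ⟨u, rfl⟩ := ha
  refine (pow_eq_one_iff_of_nonneg (norm_nonneg _) (Nat.card_pos (α := Rˣ)).ne').mp ?_
  rw [← norm_pow, ← map_pow, ← Units.val_pow_eq_pow_val, pow_card_eq_one', Units.val_one, map_one,
    norm_one]

theorem norm_mulChar_apply_le_one {R : Type*} [CommRing R] [Finite R] (χ : MulChar R ℂ) (a : R) :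
    ‖χ a‖ ≤ 1 := by
  by_cases h : IsUnit a
  · exact (norm_mulChar_apply_eq_one χ h).le
  · rw [χ.map_nonunit h, norm_zero]
    exact zero_le_one

variable {k L : Type*} [Field k] [Fintype k] [DecidableEq k] [Field L] [Fintype L] [DecidableEq L]
  [Algebra k L]

/-- The number of points where the norm of the Artin–Schreier product takes a given value. -/
theorem card_norm_eq_le {T : Finset k} (h0 : 0 ∈ T) {m d M E : ℕ} (hm : 2 ≤ m)
    (hk : m + 1 = Fintype.card k) (hd : d = T.card * Fintype.card k)
    (hM : M * M ≤ Fintype.card L) (hM' : Fintype.card L ≤ (m + 1) * (M * M))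
    (hE : E = (m + 1) * (d + 1) + 1) (hM0 : 2 * E + 2 * m ≤ M) (c : k) :
    ((Finset.univ.filter fun z : L =>
        Algebra.norm k ((artinSchreierProduct L T).eval z) = c).card : ℝ) -
      (Fintype.card L : ℝ) / m ≤ (d + (m + 1) * (1 + d + E + m) : ℕ) * (M : ℝ) := by
  obtain ⟨U, hFU, hU⟩ := exists_artinSchreierProduct_eq_X_mul (L := L) h0
  have hdvd : m ∣ Fintype.card L - 1 := by
    have h1 : m = Fintype.card k - 1 := by omega
    rw [h1, Module.card_eq_pow_finrank (K := k) (V := L)]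
    simpa using Nat.sub_dvd_pow_sub_pow (Fintype.card k) 1 (Module.finrank k L)
  have hL := Fintype.one_lt_card (α := L)
  obtain ⟨g, hg'⟩ := hdvd
  have hq : g * m + 1 = Fintype.card L := by rw [mul_comm]; omega
  have hg : 0 < g := by
    rcases Nat.eq_zero_or_pos g with rfl | h
    · omega
    · exact h
  have hdeg : (artinSchreierProduct L T).natDegree = d := by
    rw [natDegree_artinSchreierProduct, hd]
  obtain ⟨hdim, hmK⟩ := stepanov_parameters hm hq hM hE hM0 rfl
  have hMpos : 0 < M := by omega
  have hMq : M ≤ Fintype.card L := by nlinarith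
  have hst := stepanov_bound hFU hU hq hg hMq (by rw [hdeg]; exact hdim) (algebraMap k L c)
  rw [hdeg] at hst
  have hfilter : (Finset.univ.filter fun z : L =>
        Algebra.norm k ((artinSchreierProduct L T).eval z) = c) =
      Finset.univ.filter fun z : L =>
        (artinSchreierProduct L T).eval z ^ g = algebraMap k L c := by
    refine Finset.filter_congr fun z _ => ?_
    rw [← (algebraMap k L).injective.eq_iff, FiniteField.algebraMap_norm_eq_pow,
      Nat.card_eq_fintype_card, Nat.card_eq_fintype_card, ← hk, Nat.add_sub_cancel, hg',
      Nat.mul_div_cancel_left _ (by omega)]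
  rw [hfilter]
  generalize (Finset.univ.filter fun z : L =>
        (artinSchreierProduct L T).eval z ^ g = algebraMap k L c).card = n at hst ⊢
  generalize Fintype.card L = q at *
  generalize (M + E) / m + 1 = K at *
  have hmR : (0 : ℝ) < m := by exact_mod_cast (by omega : 0 < m)
  have hMR : (1 : ℝ) ≤ M := by exact_mod_cast hMpos
  have hgq : g ≤ q := by nlinarith
  have hst2 : M * n ≤ M * d + q + q * d + q * K := by
    have : g * m * d ≤ q * d := Nat.mul_le_mul_right _ (by omega)
    omega
  have hst3 : (M : ℝ) * n ≤ M * d + q + q * d + q * K := by exact_mod_cast hst2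
  have hmK' : (K : ℝ) ≤ M / m + E + 1 := by
    have h1 : (m : ℝ) * K ≤ M + E + m := by exact_mod_cast hmK
    have h2 : (K : ℝ) ≤ (M + E + m) / m := by rw [le_div_iff₀ hmR]; linarith
    refine h2.trans ?_
    rw [add_div, add_div, div_self hmR.ne']
    have : (E : ℝ) / m ≤ E := div_le_self (Nat.cast_nonneg _) (by exact_mod_cast (by omega : 1 ≤ m))
    linarith
  have hq' : (q : ℝ) ≤ (m + 1) * (M * M) := by exact_mod_cast hM'
  have hq0 : (0 : ℝ) ≤ q := Nat.cast_nonneg _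
  have hd0 : (0 : ℝ) ≤ d := Nat.cast_nonneg _
  have hE0 : (0 : ℝ) ≤ E := Nat.cast_nonneg _
  have hMp : (0 : ℝ) < M := by linarith
  have h5 : (M : ℝ) * (n - q / m) ≤ M * ((d + (m + 1) * (1 + d + E + m)) * M) := by
    have h6 : (q : ℝ) * K ≤ q * (M / m + E + 1) := mul_le_mul_of_nonneg_left hmK' hq0
    have h7 : (q : ℝ) * (1 + d + E + 1) ≤ (m + 1) * (M * M) * (1 + d + E + m) := by
      refine mul_le_mul hq' ?_ (by positivity) (by positivity)
      have : (1 : ℝ) ≤ m := by exact_mod_cast (by omega : 1 ≤ m)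
      linarith
    have h8 : (M : ℝ) * d ≤ M * d * M := le_mul_of_one_le_right (by positivity) hMR
    have h9 : (q : ℝ) * (M / m) = M * (q / m) := by ring
    nlinarith
  push_cast
  exact le_of_mul_le_mul_left h5 hMp

omit [DecidableEq L] in
/-- Square-root cancellation, with a constant independent of the extension `L`. -/
theorem norm_sum_norm_artinSchreierProduct_le {χ : MulChar k ℂ} (hχ : χ ≠ 1) {T : Finset k}
    (h0 : 0 ∈ T) {m d M E M₀ : ℕ} (hm : 2 ≤ m)
    (hk : m + 1 = Fintype.card k) (hd : d = T.card * Fintype.card k)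
    (hM : M * M ≤ Fintype.card L) (hM' : Fintype.card L ≤ (m + 1) * (M * M))
    (hE : E = (m + 1) * (d + 1) + 1) (hM0 : M₀ = 2 * E + 2 * m) :
    ‖∑ z : L, χ (Algebra.norm k ((artinSchreierProduct L T).eval z))‖ ≤
      ((2 * m + 1) * (d + (m + 1) * (1 + d + E + m)) + (m + 1) * M₀ : ℕ) * (M : ℝ) := by
  classical
  rcases le_or_gt M₀ M with hMM | hMM
  swap
  · have h1 : ‖∑ z : L, χ (Algebra.norm k ((artinSchreierProduct L T).eval z))‖ ≤
        Fintype.card L := by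
      refine (norm_sum_le _ _).trans ?_
      refine (Finset.sum_le_sum fun z _ => norm_mulChar_apply_le_one χ _).trans ?_
      simp
    refine h1.trans ?_
    have : Fintype.card L ≤
        ((2 * m + 1) * (d + (m + 1) * (1 + d + E + m)) + (m + 1) * M₀) * M := by
      refine hM'.trans ?_
      rw [← mul_assoc]
      refine Nat.mul_le_mul_right _ ?_
      have := Nat.mul_le_mul_left (m + 1) hMM.le
      omega
    exact_mod_cast this
  set F := artinSchreierProduct L T with hF
  set N : k → ℕ := fun c => (Finset.univ.filter fun z : L =>
    Algebra.norm k (F.eval z) = c).card with hN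
  set B : ℝ := (d + (m + 1) * (1 + d + E + m) : ℕ) * (M : ℝ) with hB
  have hMpos : 1 ≤ M := by omega
  have hmR : (0 : ℝ) < m := by exact_mod_cast (by omega : 0 < m)
  have hB0 : 0 ≤ B := by positivity
  have hle : ∀ c : k, (N c : ℝ) - (Fintype.card L : ℝ) / m ≤ B := fun c =>
    card_norm_eq_le h0 hm hk hd hM hM' hE (hM0 ▸ hMM) c
  have hcardE : (Finset.univ.erase (0 : k)).card = m := by
    rw [Finset.card_erase_of_mem (Finset.mem_univ _), Finset.card_univ]
    omega
  have hsumN : ∑ c : k, N c = Fintype.card L := by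
    rw [hN, ← Finset.card_eq_sum_card_fiberwise (fun _ _ => Finset.mem_coe.2 (Finset.mem_univ _)),
      Finset.card_univ]
  have hN0 : N 0 ≤ d := by
    have hF0 : F ≠ 0 := by
      obtain ⟨U, hFU, hU⟩ := exists_artinSchreierProduct_eq_X_mul (L := L) h0
      rw [hF, hFU]
      exact mul_ne_zero X_ne_zero fun h => hU (by rw [h, eval_zero])
    have : N 0 ≤ F.roots.toFinset.card := by
      refine Finset.card_le_card fun z hz => ?_
      rw [Multiset.mem_toFinset, mem_roots hF0]
      exact Algebra.norm_eq_zero_iff.1 (Finset.mem_filter.1 hz).2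
    refine this.trans ((Multiset.toFinset_card_le _).trans ((card_roots' _).trans ?_))
    rw [hF, natDegree_artinSchreierProduct, hd]
  have hsumE : -B ≤ ∑ c ∈ Finset.univ.erase (0 : k), ((N c : ℝ) - (Fintype.card L : ℝ) / m) := by
    rw [Finset.sum_sub_distrib, Finset.sum_const, hcardE, nsmul_eq_mul, mul_div_cancel₀ _ hmR.ne']
    have h1 : (N 0 : ℝ) + ∑ c ∈ Finset.univ.erase (0 : k), (N c : ℝ) = Fintype.card L := by
      rw [Finset.add_sum_erase _ (fun c => (N c : ℝ)) (Finset.mem_univ _), ← hsumN]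
      push_cast
      rfl
    have h2 : (N 0 : ℝ) ≤ B := by
      have : N 0 ≤ (d + (m + 1) * (1 + d + E + m)) * M := by
        refine hN0.trans ?_
        nlinarith [Nat.zero_le ((m + 1) * (1 + d + E + m))]
      rw [hB]
      exact_mod_cast this
    linarith
  have hmain := sum_abs_le_of_le_of_sum_ge _ _ hB0 (fun c _ => hle c) hsumE
  rw [hcardE] at hmain
  have heq : ∑ z : L, χ (Algebra.norm k (F.eval z)) =
      ∑ c ∈ Finset.univ.erase (0 : k), χ c * (((N c : ℝ) - (Fintype.card L : ℝ) / m : ℝ) : ℂ) := by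
    have h1 : ∑ z : L, χ (Algebra.norm k (F.eval z)) = ∑ c : k, χ c * (N c : ℂ) := by
      rw [← Finset.sum_fiberwise (s := Finset.univ) (g := fun z : L => Algebra.norm k (F.eval z))]
      refine Finset.sum_congr rfl fun c _ => ?_
      rw [Finset.sum_congr rfl fun z hz => by rw [(Finset.mem_filter.1 hz).2], Finset.sum_const,
        nsmul_eq_mul, mul_comm]
    have h2 : ∑ c : k, χ c * (N c : ℂ) =
        ∑ c : k, χ c * (((N c : ℝ) - (Fintype.card L : ℝ) / m : ℝ) : ℂ) := by
      push_cast
      simp only [mul_sub]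
      rw [Finset.sum_sub_distrib, ← Finset.sum_mul, MulChar.sum_eq_zero_of_ne_one hχ, zero_mul,
        sub_zero]
    rw [h1, h2, ← Finset.add_sum_erase _ _ (Finset.mem_univ (0 : k)), MulChar.map_zero, zero_mul,
      zero_add]
  rw [heq]
  calc ‖∑ c ∈ Finset.univ.erase (0 : k),
          χ c * (((N c : ℝ) - (Fintype.card L : ℝ) / m : ℝ) : ℂ)‖
      ≤ ∑ c ∈ Finset.univ.erase (0 : k), |(N c : ℝ) - (Fintype.card L : ℝ) / m| := by
        refine (norm_sum_le _ _).trans (Finset.sum_le_sum fun c _ => ?_)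
        rw [norm_mul, Complex.norm_real, Real.norm_eq_abs]
        exact mul_le_of_le_one_left (abs_nonneg _) (norm_mulChar_apply_le_one χ _)
    _ ≤ (2 * m + 1) * B := hmain
    _ ≤ _ := by
        rw [hB]
        push_cast
        have : (0 : ℝ) ≤ (m + 1) * M₀ * M := by positivity
        nlinarith

end StepanovParameters

section WeilBound

variable {p : ℕ} [Fact p.Prime]

/-- A bound for the power sums over all additive characters. -/
theorem exists_norm_sum_primePowerSum_le (hp : 3 ≤ p) {χ : MulChar (ZMod p) ℂ} (hχ : χ ≠ 1)
    {T : Finset (ZMod p)} (h0 : 0 ∈ T) :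
    ∃ B : ℝ, 0 ≤ B ∧ ∀ s : ℕ, s ≠ 0 →
      ‖∑ ψ : AddChar (ZMod p) ℂ, primePowerSum (hybridWeight χ ψ T) s‖ ≤ B * √(p : ℝ) ^ s := by
  obtain ⟨d, hd⟩ : ∃ d, d = T.card * Fintype.card (ZMod p) := ⟨_, rfl⟩
  obtain ⟨E, hE⟩ : ∃ E, E = ((p - 1) + 1) * (d + 1) + 1 := ⟨_, rfl⟩
  obtain ⟨M₀, hM₀⟩ : ∃ M₀, M₀ = 2 * E + 2 * (p - 1) := ⟨_, rfl⟩
  refine ⟨((2 * (p - 1) + 1) * (d + (p - 1 + 1) * (1 + d + E + (p - 1))) + (p - 1 + 1) * M₀ : ℕ),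
    Nat.cast_nonneg _, fun s hs => ?_⟩
  let _ : Fintype (GaloisField p s) := Fintype.ofFinite _
  have hfin : Module.finrank (ZMod p) (GaloisField p s) = s := GaloisField.finrank p hs
  have hcard : Fintype.card (GaloisField p s) = p ^ s := by
    rw [← Nat.card_eq_fintype_card, GaloisField.card p s hs]
  have hsum := sum_primePowerSum_hybridWeight (L := GaloisField p s) χ T
  rw [hfin] at hsum
  rw [hsum]
  have hM : p ^ (s / 2) * p ^ (s / 2) ≤ Fintype.card (GaloisField p s) := by
    rw [hcard, ← pow_add]
    exact Nat.pow_le_pow_right (by omega) (by omega)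
  have hM' : Fintype.card (GaloisField p s) ≤ ((p - 1) + 1) * (p ^ (s / 2) * p ^ (s / 2)) := by
    rw [hcard, ← pow_add, Nat.sub_add_cancel (by omega), ← pow_succ']
    exact Nat.pow_le_pow_right (by omega) (by omega)
  refine (norm_sum_norm_artinSchreierProduct_le (L := GaloisField p s) hχ h0 (m := p - 1)
    (by omega) (by rw [ZMod.card]; omega) hd hM hM' hE hM₀).trans ?_
  refine mul_le_mul_of_nonneg_left ?_ (Nat.cast_nonneg _)
  have hsq : (p : ℝ) = √(p : ℝ) ^ 2 := (Real.sq_sqrt (Nat.cast_nonneg _)).symm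
  have h1 : 1 ≤ √(p : ℝ) := Real.one_le_sqrt.2 (by exact_mod_cast (by omega : 1 ≤ p))
  push_cast
  conv_lhs => rw [hsq, ← pow_mul]
  exact pow_le_pow_right₀ h1 (by omega)

/-- The L-function of the hybrid weight, as a polynomial. -/
noncomputable def hybridLFunction (χ : MulChar (ZMod p) ℂ) (ψ : AddChar (ZMod p) ℂ)
    (T : Finset (ZMod p)) : ℂ[X] :=
  ∑ n ∈ Finset.range (T.card + 1), C (lCoeff (hybridWeight χ ψ T) n) * X ^ n

theorem coeff_hybridLFunction {χ : MulChar (ZMod p) ℂ} (hχ : χ ≠ 1) (ψ : AddChar (ZMod p) ℂ)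
    {T : Finset (ZMod p)} (h0 : 0 ∈ T) (n : ℕ) :
    (hybridLFunction χ ψ T).coeff n = lCoeff (hybridWeight χ ψ T) n := by
  simp only [hybridLFunction, finsetSum_coeff, coeff_C_mul_X_pow, Finset.sum_ite_eq,
    Finset.mem_range]
  split_ifs with h
  · rfl
  · rw [lCoeff_hybridWeight_eq_zero hχ ψ h0 (by omega)]

theorem natDegree_hybridLFunction_le (χ : MulChar (ZMod p) ℂ) (ψ : AddChar (ZMod p) ℂ)
    (T : Finset (ZMod p)) : (hybridLFunction χ ψ T).natDegree ≤ T.card := by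
  refine natDegree_sum_le_of_forall_le _ _ fun n hn => ?_
  exact (natDegree_C_mul_X_pow_le _ _).trans (Nat.lt_succ_iff.1 (Finset.mem_range.1 hn))

/-- Weil's bound for the hybrid sum of a product of linear factors. -/
theorem weil_bound (hp : 3 ≤ p) {χ : MulChar (ZMod p) ℂ} (hχ : χ ≠ 1) (ψ : AddChar (ZMod p) ℂ)
    {T : Finset (ZMod p)} (h0 : 0 ∈ T) :
    ‖∑ x : ZMod p, χ (∏ t ∈ T, (t + x)) * ψ x‖ ≤ T.card * √(p : ℝ) := by
  classical
  obtain ⟨B, hB, hbound⟩ := exists_norm_sum_primePowerSum_le hp hχ h0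
  have hpR : 0 < √(p : ℝ) := Real.sqrt_pos.2 (by exact_mod_cast (by omega : 0 < p))
  set a : AddChar (ZMod p) ℂ → ℕ → ℂ := fun ψ n =>
    if n = 0 then 0 else primePowerSum (hybridWeight χ ψ T) n with ha
  have hlog : ∀ ψ, IsLogDerivative (hybridLFunction χ ψ T) (PowerSeries.mk (a ψ)) := by
    intro ψ
    refine isLogDerivative_of_coeff (by simp [ha]) fun n => ?_
    rw [coeff_hybridLFunction hχ ψ h0, natCast_mul_lCoeff (hybridWeight_one χ ψ T)
      (hybridWeight_mul χ ψ T)]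
    refine Finset.sum_congr rfl fun s hs => ?_
    have : s ≠ 0 := by have := (Finset.mem_Icc.1 hs).1; omega
    simp only [ha, if_neg this, coeff_hybridLFunction hχ ψ h0]
  have hc0 : ∀ ψ, (hybridLFunction χ ψ T).coeff 0 = 1 := fun ψ => by
    rw [coeff_hybridLFunction hχ ψ h0, lCoeff_zero, hybridWeight_one]
  have hprod := IsLogDerivative.prod Finset.univ hlog
  have hmk : ∑ ψ : AddChar (ZMod p) ℂ, PowerSeries.mk (a ψ) =
      PowerSeries.mk fun n => ∑ ψ, a ψ n := by
    ext n
    simp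
  rw [hmk] at hprod
  have heval0 : (∏ ψ, hybridLFunction χ ψ T).eval 0 ≠ 0 := by
    rw [eval_prod]
    refine Finset.prod_ne_zero_iff.2 fun ψ _ => ?_
    rw [← coeff_zero_eq_eval_zero, hc0]
    exact one_ne_zero
  have hle : ∀ n, ‖∑ ψ, a ψ n‖ ≤ B * √(p : ℝ) ^ n := by
    intro n
    rcases eq_or_ne n 0 with rfl | hn
    · simp [ha, hB]
    · simpa [ha, hn] using hbound n hn
  have hroot : ∀ z : ℂ, (hybridLFunction χ ψ T).eval z = 0 → 1 ≤ √(p : ℝ) * ‖z‖ := by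
    intro z hz
    refine hprod.one_le_mul_norm_of_isRoot heval0 hpR hle ?_
    rw [eval_prod]
    exact Finset.prod_eq_zero (Finset.mem_univ ψ) hz
  have h := norm_coeff_one_le_of_roots (hc0 ψ) hpR (natDegree_hybridLFunction_le χ ψ T) hroot
  rwa [coeff_hybridLFunction hχ ψ h0, lCoeff_hybridWeight_one] at h

end WeilBound

section FourierDifferences

variable {G : Type*} [AddCommGroup G] [Fintype G] [DecidableEq G]

theorem sum_norm_sq_sum_addChar (J : Finset G) :
    ∑ ψ : AddChar G ℂ, ‖∑ v ∈ J, ψ v‖ ^ 2 = Fintype.card G * J.card := by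
  have h : ∀ ψ : AddChar G ℂ, ((‖∑ v ∈ J, ψ v‖ ^ 2 : ℝ) : ℂ) =
      ∑ v ∈ J, ∑ w ∈ J, ψ (v - w) := by
    intro ψ
    rw [Complex.ofReal_pow, ← Complex.mul_conj', map_sum, Finset.sum_mul_sum]
    refine Finset.sum_congr rfl fun v _ => Finset.sum_congr rfl fun w _ => ?_
    rw [sub_eq_add_neg, AddChar.map_add_eq_mul, AddChar.map_neg_eq_conj]
  have h2 : ((∑ ψ : AddChar G ℂ, ‖∑ v ∈ J, ψ v‖ ^ 2 : ℝ) : ℂ) =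
      ((Fintype.card G * J.card : ℝ) : ℂ) := by
    rw [Complex.ofReal_sum, Finset.sum_congr rfl fun ψ _ => h ψ, Finset.sum_comm]
    rw [Finset.sum_congr rfl fun v _ => Finset.sum_comm]
    simp only [AddChar.sum_apply_eq_ite, sub_eq_zero]
    simp [Finset.sum_ite_eq, mul_comm]
  exact_mod_cast h2

theorem norm_sum_sub_le (g : G → ℂ) {W : ℝ}
    (hg : ∀ ψ : AddChar G ℂ, ‖∑ x, g x * ψ x‖ ≤ W) (J J' : Finset G) :
    ‖∑ u ∈ J, ∑ v ∈ J', g (u - v)‖ ≤ W * √(J.card * J'.card) := by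
  have hq : (0 : ℝ) < Fintype.card G := by exact_mod_cast Fintype.card_pos
  have hinv : ∀ y : G, (Fintype.card G : ℂ) * g y =
      ∑ ψ : AddChar G ℂ, (∑ x, g x * ψ x) * ψ (-y) := by
    intro y
    simp only [Finset.sum_mul]
    rw [Finset.sum_comm]
    simp only [mul_assoc, ← AddChar.map_add_eq_mul, ← Finset.mul_sum, AddChar.sum_apply_eq_ite,
      add_neg_eq_zero]
    simp [mul_comm]
  have hexp : (Fintype.card G : ℂ) * ∑ u ∈ J, ∑ v ∈ J', g (u - v) =
      ∑ ψ : AddChar G ℂ, (∑ x, g x * ψ x) *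
        ((starRingEnd ℂ) (∑ u ∈ J, ψ u) * ∑ v ∈ J', ψ v) := by
    simp only [Finset.mul_sum, hinv, map_sum, Finset.sum_mul]
    rw [Finset.sum_congr rfl fun u _ => Finset.sum_comm, Finset.sum_comm]
    refine Finset.sum_congr rfl fun ψ _ => ?_
    rw [Finset.sum_comm]
    refine Finset.sum_congr rfl fun v _ => Finset.sum_congr rfl fun u _ => ?_
    refine Finset.sum_congr rfl fun x _ => ?_
    rw [neg_sub, sub_eq_add_neg, AddChar.map_add_eq_mul, AddChar.map_neg_eq_conj]
    ring
  have hnorm : Fintype.card G * ‖∑ u ∈ J, ∑ v ∈ J', g (u - v)‖ ≤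
      W * ∑ ψ : AddChar G ℂ, ‖∑ u ∈ J, ψ u‖ * ‖∑ v ∈ J', ψ v‖ := by
    have h1 : Fintype.card G * ‖∑ u ∈ J, ∑ v ∈ J', g (u - v)‖ =
        ‖(Fintype.card G : ℂ) * ∑ u ∈ J, ∑ v ∈ J', g (u - v)‖ := by simp
    rw [h1, hexp, Finset.mul_sum]
    refine (norm_sum_le _ _).trans (Finset.sum_le_sum fun ψ _ => ?_)
    rw [norm_mul, norm_mul, RCLike.norm_conj]
    exact mul_le_mul_of_nonneg_right (hg ψ) (by positivity)
  have hW : 0 ≤ W := (norm_nonneg _).trans (hg 0)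
  have hcs : ∑ ψ : AddChar G ℂ, ‖∑ u ∈ J, ψ u‖ * ‖∑ v ∈ J', ψ v‖ ≤
      Fintype.card G * √(J.card * J'.card) := by
    refine (Real.sum_mul_le_sqrt_mul_sqrt _ _ _).trans ?_
    rw [sum_norm_sq_sum_addChar, sum_norm_sq_sum_addChar, Real.sqrt_mul hq.le,
      Real.sqrt_mul hq.le, Real.sqrt_mul (Nat.cast_nonneg _)]
    rw [mul_mul_mul_comm, Real.mul_self_sqrt hq.le]
  have h3 := hnorm.trans (mul_le_mul_of_nonneg_left hcs hW)
  rw [← mul_assoc, mul_comm W, mul_assoc] at h3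
  exact le_of_mul_le_mul_left h3 hq

omit [Fintype G] in
theorem sum_sum_indicator_sub_le (Z J J' : Finset G) :
    ∑ u ∈ J, ∑ v ∈ J', (if u - v ∈ Z then (1 : ℝ) else 0) ≤ Z.card * J'.card := by
  rw [Finset.sum_comm]
  have : ∀ v ∈ J', ∑ u ∈ J, (if u - v ∈ Z then (1 : ℝ) else 0) ≤ Z.card := by
    intro v _
    rw [Finset.sum_boole]
    norm_cast
    refine Finset.card_le_card_of_injOn (fun u => u - v) (fun u hu => (Finset.mem_filter.1 hu).2) ?_
    intro a _ b _ h
    simpa using h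
  refine (Finset.sum_le_sum this).trans ?_
  rw [Finset.sum_const, nsmul_eq_mul, mul_comm]

end FourierDifferences

section ShiftedProducts

variable {p : ℕ} [Fact p.Prime]

/-- The product `(x + 1) ⋯ (x + k)`. -/
def shiftedProduct (k : ℕ) (x : ZMod p) : ZMod p := ∏ i ∈ Finset.Icc 1 k, (x + (i : ZMod p))

theorem factorial_add_eq_mul_shiftedProduct (n k : ℕ) :
    (((n + k).factorial : ℕ) : ZMod p) = (n.factorial : ZMod p) * shiftedProduct k (n : ZMod p) := by
  induction k with
  | zero => simp [shiftedProduct]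
  | succ k ih =>
    rw [← add_assoc, Nat.factorial_succ, Nat.cast_mul, ih, shiftedProduct, shiftedProduct,
      Finset.prod_Icc_succ_top (by omega)]
    push_cast
    ring

theorem shiftedProduct_eq_mul {k l : ℕ} (h : k ≤ l) (x : ZMod p) :
    shiftedProduct l x = shiftedProduct k x * ∏ i ∈ Finset.Ioc k l, (x + (i : ZMod p)) := by
  have h1 : ∀ n : ℕ, Finset.Icc 1 n = Finset.Ioc 0 n := fun n => by
    ext i; simp [Nat.succ_le_iff]
  rw [shiftedProduct, shiftedProduct, h1, h1,
    Finset.prod_Ioc_consecutive _ (Nat.zero_le k) h]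

theorem norm_sum_mulChar_prod_Ioc_le (hp : 3 ≤ p) {χ : MulChar (ZMod p) ℂ} (hχ : χ ≠ 1)
    (ψ : AddChar (ZMod p) ℂ) {k l K : ℕ} (hkl : k < l) (hl : l ≤ K) (hK : K < p) :
    ‖∑ x : ZMod p, χ (∏ i ∈ Finset.Ioc k l, (x + (i : ZMod p))) * ψ x‖ ≤ K * √(p : ℝ) := by
  have hinj : Set.InjOn (fun i : ℕ => (i : ZMod p) - (l : ZMod p)) (Finset.Ioc k l) := by
    intro i hi j hj h
    have h' : (i : ZMod p) = j := by simpa using h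
    have hi' := (Finset.mem_Ioc.1 hi).2
    have hj' := (Finset.mem_Ioc.1 hj).2
    rw [ZMod.natCast_eq_natCast_iff', Nat.mod_eq_of_lt (by omega), Nat.mod_eq_of_lt (by omega)] at h'
    exact h'
  set T : Finset (ZMod p) := (Finset.Ioc k l).image fun i : ℕ => (i : ZMod p) - (l : ZMod p) with hT
  have h0 : (0 : ZMod p) ∈ T :=
    Finset.mem_image.2 ⟨l, Finset.mem_Ioc.2 ⟨hkl, le_rfl⟩, sub_self _⟩
  have hcard : T.card ≤ K := Finset.card_image_le.trans (by rw [Nat.card_Ioc]; omega)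
  have hsum : ∑ x : ZMod p, χ (∏ i ∈ Finset.Ioc k l, (x + (i : ZMod p))) * ψ x =
      (∑ x : ZMod p, χ (∏ t ∈ T, (t + x)) * ψ x) * ψ (-(l : ZMod p)) := by
    rw [← Equiv.sum_comp (Equiv.subRight (l : ZMod p)), Finset.sum_mul]
    refine Finset.sum_congr rfl fun x _ => ?_
    rw [hT, Finset.prod_image hinj, Equiv.subRight_apply, sub_eq_add_neg, AddChar.map_add_eq_mul,
      ← mul_assoc]
    congr 3
    refine Finset.prod_congr rfl fun i _ => ?_
    ring
  rw [hsum, norm_mul, AddChar.norm_apply, mul_one]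
  exact (weil_bound hp hχ ψ h0).trans
    (mul_le_mul_of_nonneg_right (by exact_mod_cast hcard) (Real.sqrt_nonneg _))

/-- Correlation of two shifted products over a set of differences. -/
theorem norm_sum_shiftedProduct_mul_conj_le (hp : 3 ≤ p) {χ : MulChar (ZMod p) ℂ} (hχ : χ ≠ 1)
    {k l K : ℕ} (hkl : k < l) (hl : l ≤ K) (hK : K < p) (J J' : Finset (ZMod p)) :
    ‖∑ u ∈ J, ∑ v ∈ J', (starRingEnd ℂ) (χ (shiftedProduct k (u - v))) *
        χ (shiftedProduct l (u - v))‖ ≤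
      K * √(p : ℝ) * √(J.card * J'.card) + K * J'.card := by
  set Z : Finset (ZMod p) := (Finset.Icc 1 k).image fun i : ℕ => -(i : ZMod p) with hZ
  have hZcard : (Z.card : ℝ) ≤ K := by
    have : Z.card ≤ K := Finset.card_image_le.trans (by rw [Nat.card_Icc]; omega)
    exact_mod_cast this
  set g : ZMod p → ℂ := fun x => χ (∏ i ∈ Finset.Ioc k l, (x + (i : ZMod p))) with hg
  have hpt : ∀ x : ZMod p, ‖(starRingEnd ℂ) (χ (shiftedProduct k x)) * χ (shiftedProduct l x) - g x‖
      ≤ if x ∈ Z then (1 : ℝ) else 0 := by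
    intro x
    rw [shiftedProduct_eq_mul hkl.le, map_mul, ← mul_assoc, mul_comm ((starRingEnd ℂ) _),
      Complex.mul_conj']
    by_cases hx : shiftedProduct k x = 0
    · have hxZ : x ∈ Z := by
        obtain ⟨i, hi, h⟩ := Finset.prod_eq_zero_iff.1 hx
        exact Finset.mem_image.2 ⟨i, hi, (eq_neg_of_add_eq_zero_left h).symm⟩
      rw [if_pos hxZ, hx, MulChar.map_zero, norm_zero, Complex.ofReal_zero,
        zero_pow two_ne_zero, zero_mul, zero_sub, norm_neg]
      exact norm_mulChar_apply_le_one χ _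
    · rw [norm_mulChar_apply_eq_one χ (IsUnit.mk0 _ hx)]
      have : (0 : ℝ) ≤ if x ∈ Z then (1 : ℝ) else 0 := by split_ifs <;> norm_num
      simpa [hg] using this
  have h1 := norm_sum_sub_le g
    (fun ψ => norm_sum_mulChar_prod_Ioc_le hp hχ ψ hkl hl hK) J J'
  have h2 : ‖∑ u ∈ J, ∑ v ∈ J', ((starRingEnd ℂ) (χ (shiftedProduct k (u - v))) *
        χ (shiftedProduct l (u - v)) - g (u - v))‖ ≤ K * J'.card := by
    refine (norm_sum_le _ _).trans ((Finset.sum_le_sum fun u _ => (norm_sum_le _ _).trans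
      (Finset.sum_le_sum fun v _ => hpt (u - v))).trans ?_)
    exact (sum_sum_indicator_sub_le Z J J').trans
      (mul_le_mul_of_nonneg_right hZcard (Nat.cast_nonneg _))
  simp only [Finset.sum_sub_distrib] at h2
  have h3 := norm_add_le (∑ u ∈ J, ∑ v ∈ J', (starRingEnd ℂ) (χ (shiftedProduct k (u - v))) *
        χ (shiftedProduct l (u - v)) - ∑ u ∈ J, ∑ v ∈ J', g (u - v))
        (∑ u ∈ J, ∑ v ∈ J', g (u - v))
  rw [sub_add_cancel] at h3
  linarith

end ShiftedProducts

section MeanSquare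

variable {p : ℕ} [Fact p.Prime]

/-- Mean square over all differences of two sets. -/
theorem sum_sum_norm_sq_le (hp : 3 ≤ p) {χ : MulChar (ZMod p) ℂ} (hχ : χ ≠ 1) {K N : ℕ}
    (hK : K < p) {J J' : Finset (ZMod p)} (hJ : J.card ≤ 2 * N) (hJ' : J'.card ≤ N) :
    ∑ u ∈ J, ∑ v ∈ J', ‖∑ k ∈ Finset.Icc 1 K, χ (shiftedProduct k (u - v))‖ ^ 2 ≤
      2 * K * N ^ 2 + 3 * K ^ 3 * N * √(p : ℝ) := by
  have hsq1 : 1 ≤ √(p : ℝ) := Real.one_le_sqrt.2 (by exact_mod_cast (by omega : 1 ≤ p))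
  have hJR : (J.card : ℝ) ≤ 2 * N := by exact_mod_cast hJ
  have hJR' : (J'.card : ℝ) ≤ N := by exact_mod_cast hJ'
  have hprod : (J.card : ℝ) * J'.card ≤ 2 * N ^ 2 := by
    have := mul_le_mul hJR hJR' (Nat.cast_nonneg _) (by positivity)
    linarith
  have hsqrt : √((J.card : ℝ) * J'.card) ≤ 2 * N := by
    rw [Real.sqrt_le_left (by positivity)]
    nlinarith [sq_nonneg (N : ℝ)]
  set S : ℕ → ℕ → ℂ := fun k l => ∑ u ∈ J, ∑ v ∈ J',
    (starRingEnd ℂ) (χ (shiftedProduct k (u - v))) * χ (shiftedProduct l (u - v)) with hS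
  set W : ℝ := 3 * K * N * √(p : ℝ) with hW
  have hW0 : 0 ≤ W := by positivity
  have hlt : ∀ k l, k < l → l ≤ K → ‖S k l‖ ≤ W := by
    intro k l hkl hl
    refine (norm_sum_shiftedProduct_mul_conj_le hp hχ hkl hl hK J J').trans ?_
    have h1 : (K : ℝ) * √(p : ℝ) * √(J.card * J'.card) ≤ K * √(p : ℝ) * (2 * N) :=
      mul_le_mul_of_nonneg_left hsqrt (by positivity)
    have h2 : (K : ℝ) * J'.card ≤ K * N := mul_le_mul_of_nonneg_left hJR' (Nat.cast_nonneg _)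
    have h3 : (K : ℝ) * N ≤ K * N * √(p : ℝ) := le_mul_of_one_le_right (by positivity) hsq1
    rw [hW]
    linarith
  have hconj : ∀ k l, S k l = (starRingEnd ℂ) (S l k) := by
    intro k l
    simp only [hS, map_sum, map_mul, Complex.conj_conj]
    refine Finset.sum_congr rfl fun u _ => Finset.sum_congr rfl fun v _ => mul_comm _ _
  have hdiag : ∀ k, ‖S k k‖ ≤ 2 * N ^ 2 := by
    intro k
    refine (norm_sum_le _ _).trans ((Finset.sum_le_sum fun u _ => (norm_sum_le _ _).trans
      (Finset.sum_le_sum fun v _ => (?_ : _ ≤ (1 : ℝ)))).trans ?_)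
    · rw [norm_mul, RCLike.norm_conj]
      exact mul_le_one₀ (norm_mulChar_apply_le_one χ _) (norm_nonneg _)
        (norm_mulChar_apply_le_one χ _)
    · simpa using hprod
  have hall : ∀ k ∈ Finset.Icc 1 K, ∀ l ∈ Finset.Icc 1 K,
      ‖S k l‖ ≤ (if k = l then 2 * (N : ℝ) ^ 2 else 0) + W := by
    intro k hk l hl
    rcases lt_trichotomy k l with h | h | h
    · rw [if_neg h.ne, zero_add]
      exact hlt k l h (Finset.mem_Icc.1 hl).2
    · rw [if_pos h, h]
      linarith [hdiag l]
    · rw [if_neg h.ne', zero_add, hconj, RCLike.norm_conj]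
      exact hlt l k h (Finset.mem_Icc.1 hk).2
  have hexp : ((∑ u ∈ J, ∑ v ∈ J',
      ‖∑ k ∈ Finset.Icc 1 K, χ (shiftedProduct k (u - v))‖ ^ 2 : ℝ) : ℂ) =
      ∑ k ∈ Finset.Icc 1 K, ∑ l ∈ Finset.Icc 1 K, S k l := by
    push_cast
    simp only [← Complex.conj_mul', map_sum, Finset.sum_mul_sum, hS]
    rw [Finset.sum_congr rfl fun u _ => Finset.sum_comm, Finset.sum_comm]
    refine Finset.sum_congr rfl fun k _ => ?_
    rw [Finset.sum_congr rfl fun u _ => Finset.sum_congr rfl fun v _ => rfl,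
      Finset.sum_congr rfl fun u _ => Finset.sum_comm, Finset.sum_comm]
  have hnn : 0 ≤ ∑ u ∈ J, ∑ v ∈ J',
      ‖∑ k ∈ Finset.Icc 1 K, χ (shiftedProduct k (u - v))‖ ^ 2 := by positivity
  have hnorm : ∑ u ∈ J, ∑ v ∈ J', ‖∑ k ∈ Finset.Icc 1 K, χ (shiftedProduct k (u - v))‖ ^ 2 =
      ‖∑ k ∈ Finset.Icc 1 K, ∑ l ∈ Finset.Icc 1 K, S k l‖ := by
    rw [← hexp, Complex.norm_real, Real.norm_of_nonneg hnn]
  rw [hnorm]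
  refine (norm_sum_le _ _).trans ((Finset.sum_le_sum fun k hk => (norm_sum_le _ _).trans
    (Finset.sum_le_sum fun l hl => hall k hk l hl)).trans ?_)
  have : ∀ k ∈ Finset.Icc 1 K, ∑ l ∈ Finset.Icc 1 K,
      ((if k = l then 2 * (N : ℝ) ^ 2 else 0) + W) = 2 * (N : ℝ) ^ 2 + K * W := by
    intro k hk
    rw [Finset.sum_add_distrib, Finset.sum_ite_eq, if_pos hk]
    simp
  rw [Finset.sum_congr rfl this, Finset.sum_const, Nat.card_Icc, nsmul_eq_mul, hW]
  simp only [Nat.add_sub_cancel]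
  apply le_of_eq
  ring

/-- Mean square over an interval. -/
theorem sum_Icc_norm_sq_le (hp : 3 ≤ p) {χ : MulChar (ZMod p) ℂ} (hχ : χ ≠ 1) {H K N : ℕ}
    (hN : 0 < N) (hHN : H + N < p) (hK : K < p) :
    ∑ n ∈ Finset.Icc (H + 1) (H + N),
        ‖∑ k ∈ Finset.Icc 1 K, χ (shiftedProduct k (n : ZMod p))‖ ^ 2 ≤
      2 * K * N + 3 * K ^ 3 * √(p : ℝ) := by
  classical
  set Φ : ZMod p → ℝ := fun x => ‖∑ k ∈ Finset.Icc 1 K, χ (shiftedProduct k x)‖ ^ 2 with hΦ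
  have hΦ0 : ∀ x, 0 ≤ Φ x := fun x => sq_nonneg _
  set J : Finset (ZMod p) := (Finset.Icc (H + 1) (H + 2 * N)).image fun n : ℕ => (n : ZMod p)
  set J' : Finset (ZMod p) := (Finset.range N).image fun n : ℕ => (n : ZMod p)
  have hJ : J.card ≤ 2 * N := Finset.card_image_le.trans (by rw [Nat.card_Icc]; omega)
  have hJ' : J'.card ≤ N := Finset.card_image_le.trans (by rw [Finset.card_range])
  have hmain := sum_sum_norm_sq_le hp hχ hK hJ hJ'
  have hinj : Set.InjOn (fun a : ℕ × ℕ => (((a.1 + a.2 : ℕ) : ZMod p), ((a.2 : ℕ) : ZMod p)))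
      (Finset.Icc (H + 1) (H + N) ×ˢ Finset.range N : Finset (ℕ × ℕ)) := by
    rintro ⟨n, v⟩ h1 ⟨n', v'⟩ h2 h
    have h1' := Finset.mem_product.1 (Finset.mem_coe.1 h1)
    have h2' := Finset.mem_product.1 (Finset.mem_coe.1 h2)
    simp only [Finset.mem_Icc, Finset.mem_range] at h1' h2'
    simp only [Prod.mk.injEq] at h
    obtain ⟨ha, hb⟩ := h
    have hn : (n : ZMod p) = n' := by
      push_cast at ha
      rw [hb] at ha
      exact add_right_cancel ha
    rw [ZMod.natCast_eq_natCast_iff', Nat.mod_eq_of_lt (by omega), Nat.mod_eq_of_lt (by omega)]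
      at hb hn
    rw [hn, hb]
  have hle : (N : ℝ) * ∑ n ∈ Finset.Icc (H + 1) (H + N), Φ (n : ZMod p) ≤
      ∑ u ∈ J, ∑ v ∈ J', Φ (u - v) := by
    have h1 : (N : ℝ) * ∑ n ∈ Finset.Icc (H + 1) (H + N), Φ (n : ZMod p) =
        ∑ a ∈ Finset.Icc (H + 1) (H + N) ×ˢ Finset.range N,
          Φ (((a.1 + a.2 : ℕ) : ZMod p) - ((a.2 : ℕ) : ZMod p)) := by
      rw [Finset.sum_product, Finset.mul_sum]
      refine Finset.sum_congr rfl fun n _ => ?_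
      simp
    rw [h1, ← Finset.sum_product']
    rw [← Finset.sum_image (f := fun b : ZMod p × ZMod p => Φ (b.1 - b.2)) hinj]
    refine Finset.sum_le_sum_of_subset_of_nonneg ?_ fun b _ _ => hΦ0 _
    intro b hb
    obtain ⟨⟨n, v⟩, hnv, rfl⟩ := Finset.mem_image.1 hb
    simp only [Finset.mem_product, Finset.mem_Icc, Finset.mem_range] at hnv
    exact Finset.mem_product.2 ⟨Finset.mem_image.2 ⟨n + v, Finset.mem_Icc.2 (by omega), rfl⟩,
      Finset.mem_image.2 ⟨v, Finset.mem_range.2 hnv.2, rfl⟩⟩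
  have hNR : (0 : ℝ) < N := by exact_mod_cast hN
  refine le_of_mul_le_mul_left ((hle.trans hmain).trans (le_of_eq ?_)) hNR
  ring

/-- Shifting the argument of the factorials and averaging. -/
theorem natCast_mul_norm_sum_factorial_le (χ : MulChar (ZMod p) ℂ) (H K N : ℕ) :
    (K : ℝ) * ‖∑ n ∈ Finset.Icc (H + 1) (H + N), χ (n.factorial : ZMod p)‖ ≤
      ∑ n ∈ Finset.Icc (H + 1) (H + N),
        ‖∑ k ∈ Finset.Icc 1 K, χ (shiftedProduct k (n : ZMod p))‖ + 2 * K ^ 2 := by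
  set I := Finset.Icc (H + 1) (H + N) with hI
  set f : ℕ → ℂ := fun n => χ (n.factorial : ZMod p) with hf
  have hf1 : ∀ n, ‖f n‖ ≤ 1 := fun n => norm_mulChar_apply_le_one χ _
  have hshift : ∀ k, ‖∑ n ∈ I, f n - ∑ n ∈ I, f (n + k)‖ ≤ 2 * k := by
    intro k
    induction k with
    | zero => simp
    | succ k ih =>
      have h1 : ‖∑ n ∈ I, f (n + k) - ∑ n ∈ I, f (n + (k + 1))‖ ≤ 2 := by
        rw [← Finset.sum_sub_distrib, hI, ← Finset.Ico_succ_right_eq_Icc, Finset.sum_Ico_eq_sum_range]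
        have : ∀ j, f (H + 1 + j + k) - f (H + 1 + j + (k + 1)) =
            f (H + 1 + k + j) - f (H + 1 + k + (j + 1)) := by
          intro j
          congr 2 <;> ring
        simp only [this]
        rw [Finset.sum_range_sub' fun j => f (H + 1 + k + j)]
        refine (norm_sub_le _ _).trans ?_
        linarith [hf1 (H + 1 + k + 0), hf1 (H + 1 + k + (Order.succ (H + N) - (H + 1)))]
      have h2 := norm_add_le (∑ n ∈ I, f n - ∑ n ∈ I, f (n + k))
        (∑ n ∈ I, f (n + k) - ∑ n ∈ I, f (n + (k + 1)))
      rw [sub_add_sub_cancel] at h2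
      push_cast
      linarith
  have hval : ∑ k ∈ Finset.Icc 1 K, ∑ n ∈ I, f (n + k) =
      ∑ n ∈ I, f n * ∑ k ∈ Finset.Icc 1 K, χ (shiftedProduct k (n : ZMod p)) := by
    rw [Finset.sum_comm]
    refine Finset.sum_congr rfl fun n _ => ?_
    rw [Finset.mul_sum]
    refine Finset.sum_congr rfl fun k _ => ?_
    simp only [hf]
    rw [factorial_add_eq_mul_shiftedProduct, map_mul]
  have h1 : ‖(K : ℂ) * ∑ n ∈ I, f n - ∑ k ∈ Finset.Icc 1 K, ∑ n ∈ I, f (n + k)‖ ≤ 2 * K ^ 2 := by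
    have : (K : ℂ) * ∑ n ∈ I, f n = ∑ k ∈ Finset.Icc 1 K, ∑ n ∈ I, f n := by simp
    rw [this, ← Finset.sum_sub_distrib]
    refine (norm_sum_le _ _).trans ((Finset.sum_le_sum fun k hk =>
      (hshift k).trans (?_ : _ ≤ 2 * (K : ℝ))).trans ?_)
    · have := (Finset.mem_Icc.1 hk).2
      have : (k : ℝ) ≤ K := by exact_mod_cast this
      linarith
    · rw [Finset.sum_const, Nat.card_Icc, nsmul_eq_mul, Nat.add_sub_cancel]
      apply le_of_eq
      ring
  have h2 : ‖∑ k ∈ Finset.Icc 1 K, ∑ n ∈ I, f (n + k)‖ ≤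
      ∑ n ∈ I, ‖∑ k ∈ Finset.Icc 1 K, χ (shiftedProduct k (n : ZMod p))‖ := by
    rw [hval]
    refine (norm_sum_le _ _).trans (Finset.sum_le_sum fun n _ => ?_)
    rw [norm_mul]
    exact mul_le_of_le_one_left (norm_nonneg _) (hf1 n)
  have h3 := norm_add_le ((K : ℂ) * ∑ n ∈ I, f n - ∑ k ∈ Finset.Icc 1 K, ∑ n ∈ I, f (n + k))
    (∑ k ∈ Finset.Icc 1 K, ∑ n ∈ I, f (n + k))
  rw [sub_add_cancel, norm_mul, Complex.norm_natCast] at h3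
  linarith

/-- The character sum over factorials, in terms of the averaging parameter. -/
theorem norm_sum_factorial_le_of_parameter (hp : 3 ≤ p) {χ : MulChar (ZMod p) ℂ} (hχ : χ ≠ 1)
    {H K N : ℕ} (hN : 0 < N) (hHN : H + N < p) (hK : K < p) :
    (K : ℝ) * ‖∑ n ∈ Finset.Icc (H + 1) (H + N), χ (n.factorial : ZMod p)‖ ≤
      √(N * (2 * K * N + 3 * K ^ 3 * √(p : ℝ))) + 2 * K ^ 2 := by
  refine (natCast_mul_norm_sum_factorial_le χ H K N).trans (add_le_add_left ?_ _)
  have hcs := Real.sum_mul_le_sqrt_mul_sqrt (Finset.Icc (H + 1) (H + N)) (fun _ => (1 : ℝ))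
    fun n => ‖∑ k ∈ Finset.Icc 1 K, χ (shiftedProduct k (n : ZMod p))‖
  simp only [one_mul, one_pow, Finset.sum_const, Nat.card_Icc, nsmul_eq_mul, mul_one] at hcs
  refine hcs.trans ?_
  rw [← Real.sqrt_mul (Nat.cast_nonneg _), (by omega : H + N + 1 - (H + 1) = N)]
  exact Real.sqrt_le_sqrt (mul_le_mul_of_nonneg_left (sum_Icc_norm_sq_le hp hχ hN hHN hK)
    (Nat.cast_nonneg _))

/-- Character sums over factorials in short intervals. -/
theorem norm_sum_factorial_le (hp : 3 ≤ p) {χ : MulChar (ZMod p) ℂ} (hχ : χ ≠ 1)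
    {H N : ℕ} (hN : 0 < N) (hHN : H + N < p) :
    ‖∑ n ∈ Finset.Icc (H + 1) (H + N), χ (n.factorial : ZMod p)‖ ≤
      7 * ((N : ℝ) ^ ((3 : ℝ) / 4) * (p : ℝ) ^ ((1 : ℝ) / 8)) := by
  have hp0 : (0 : ℝ) < p := by exact_mod_cast (by omega : 0 < p)
  have hN0 : (0 : ℝ) < N := by exact_mod_cast hN
  have hN1 : (1 : ℝ) ≤ N := by exact_mod_cast hN
  have hp1 : (1 : ℝ) ≤ p := by exact_mod_cast (by omega : 1 ≤ p)
  set S := ‖∑ n ∈ Finset.Icc (H + 1) (H + N), χ (n.factorial : ZMod p)‖ with hS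
  obtain ⟨b, hb0, hb⟩ : ∃ b : ℝ, 1 ≤ b ∧ b = (p : ℝ) ^ ((1 : ℝ) / 8) :=
    ⟨_, Real.one_le_rpow hp1 (by norm_num), rfl⟩
  obtain ⟨c, hc0, hc⟩ : ∃ c : ℝ, 1 ≤ c ∧ c = (N : ℝ) ^ ((1 : ℝ) / 4) :=
    ⟨_, Real.one_le_rpow hN1 (by norm_num), rfl⟩
  have hc4 : (N : ℝ) = c ^ 4 := by
    rw [hc, ← Real.rpow_natCast, ← Real.rpow_mul hN0.le]
    norm_num
  have hc3 : (N : ℝ) ^ ((3 : ℝ) / 4) = c ^ 3 := by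
    rw [hc, ← Real.rpow_natCast, ← Real.rpow_mul hN0.le]
    norm_num
  have hb4 : √(p : ℝ) = b ^ 4 := by
    rw [hb, ← Real.rpow_natCast, ← Real.rpow_mul hp0.le, Real.sqrt_eq_rpow]
    norm_num
  rw [hc3, ← hb]
  rcases le_or_gt c b with hcb | hcb
  · have hSN : S ≤ N := by
      refine (norm_sum_le _ _).trans ((Finset.sum_le_sum fun n _ =>
        norm_mulChar_apply_le_one χ _).trans ?_)
      rw [Finset.sum_const, Nat.card_Icc, nsmul_eq_mul, mul_one,
        (by omega : H + N + 1 - (H + 1) = N)]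
    have : c ^ 4 ≤ c ^ 3 * b := by
      rw [pow_succ]
      exact mul_le_mul_of_nonneg_left hcb (by positivity)
    have : 0 ≤ c ^ 3 * b := by positivity
    linarith
  · set a : ℝ := c ^ 2 / b ^ 2 with ha
    have ha1 : 1 ≤ a := by
      rw [ha, le_div_iff₀ (by positivity), one_mul]
      gcongr
    obtain ⟨K, hKa, hKa'⟩ : ∃ K : ℕ, a ≤ K ∧ (K : ℝ) < a + 1 :=
      ⟨⌈a⌉₊, Nat.le_ceil a, Nat.ceil_lt_add_one (by linarith)⟩
    have haN : a ≤ N := by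
      rw [hc4, ha]
      calc c ^ 2 / b ^ 2 ≤ c ^ 2 := div_le_self (by positivity) (one_le_pow₀ hb0)
        _ ≤ c ^ 4 := pow_le_pow_right₀ hc0 (by norm_num)
    have hKN : K < N + 1 := by
      have : (K : ℝ) < N + 1 := by linarith
      exact_mod_cast this
    have hKp : K < p := by omega
    have hK2 : (K : ℝ) ≤ 2 * a := by linarith
    have hK0 : (0 : ℝ) < K := by linarith
    have hmain := norm_sum_factorial_le_of_parameter hp hχ hN hHN hKp
    have hab : a * b ^ 2 = c ^ 2 := by rw [ha]; field_simp
    have hroot : √(N * (2 * K * N + 3 * K ^ 3 * √(p : ℝ))) ≤ K * (3 * (c ^ 3 * b)) := by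
      rw [Real.sqrt_le_left (by positivity), hb4, hc4]
      have e1 : c ^ 8 ≤ K * (c ^ 6 * b ^ 2) := by
        calc c ^ 8 = a * (c ^ 6 * b ^ 2) := by linear_combination (-c ^ 6) * hab
          _ ≤ K * (c ^ 6 * b ^ 2) := mul_le_mul_of_nonneg_right hKa (by positivity)
      have e2 : K * (c ^ 4 * b ^ 4) ≤ 2 * (c ^ 6 * b ^ 2) := by
        calc K * (c ^ 4 * b ^ 4) ≤ (2 * a) * (c ^ 4 * b ^ 4) :=
              mul_le_mul_of_nonneg_right hK2 (by positivity)
          _ = 2 * (c ^ 6 * b ^ 2) := by linear_combination (2 * c ^ 4 * b ^ 2) * hab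
      have e3 := mul_le_mul_of_nonneg_left e1 (by positivity : (0 : ℝ) ≤ 2 * K)
      have e4 := mul_le_mul_of_nonneg_left e2 (by positivity : (0 : ℝ) ≤ 3 * K ^ 2)
      have e5 : 0 ≤ (K : ℝ) ^ 2 * (c ^ 6 * b ^ 2) := by positivity
      nlinarith
    have hac : a ≤ c ^ 3 * b := by
      calc a ≤ c ^ 2 := div_le_self (by positivity) (one_le_pow₀ hb0)
        _ ≤ c ^ 3 := pow_le_pow_right₀ hc0 (by norm_num)
        _ ≤ c ^ 3 * b := le_mul_of_one_le_right (by positivity) hb0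
    have hfin : (K : ℝ) * S ≤ K * (7 * (c ^ 3 * b)) := by
      have : (K : ℝ) * (2 * K) ≤ K * (4 * (c ^ 3 * b)) :=
        mul_le_mul_of_nonneg_left (by linarith) hK0.le
      nlinarith
    exact le_of_mul_le_mul_left hfin hK0

end MeanSquare

section SquarefreeDivisors

theorem card_squarefree_divisors_le {n : ℕ} (hn : n ≠ 0) :
    (n.divisors.filter Squarefree).card ≤ 2 ^ n.primeFactors.card := by
  rw [← Finset.card_powerset]
  refine Finset.card_le_card_of_injOn Nat.primeFactors (fun d hd => ?_) ?_
  · have := Nat.dvd_of_mem_divisors (Finset.mem_filter.1 hd).1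
    exact Finset.mem_coe.2 (Finset.mem_powerset.2 (Nat.primeFactors_mono this hn))
  · intro d hd e he h
    rw [← Nat.prod_primeFactors_of_squarefree (Finset.mem_filter.1 hd).2,
      ← Nat.prod_primeFactors_of_squarefree (Finset.mem_filter.1 he).2, h]

theorem exists_two_pow_card_primeFactors_le {ε : ℝ} (hε : 0 < ε) :
    ∃ C : ℝ, 0 < C ∧ ∀ n : ℕ, n ≠ 0 → (2 : ℝ) ^ n.primeFactors.card ≤ C * (n : ℝ) ^ ε := by
  obtain ⟨y, hy⟩ := exists_nat_ge ((2 : ℝ) ^ (1 / ε))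
  refine ⟨2 ^ y, by positivity, fun n hn => ?_⟩
  have hterm : ∀ q ∈ n.primeFactors, (2 : ℝ) ≤ (if q < y then 2 else 1) * (q : ℝ) ^ ε := by
    intro q hq
    have hq1 : (1 : ℝ) ≤ q := by exact_mod_cast (Nat.prime_of_mem_primeFactors hq).one_le
    split_ifs with h
    · linarith [Real.one_le_rpow hq1 hε.le]
    · have h1 : (2 : ℝ) ^ (1 / ε) ≤ q := hy.trans (by exact_mod_cast not_lt.1 h)
      have h2 := Real.rpow_le_rpow (by positivity) h1 hε.le
      rw [← Real.rpow_mul (by norm_num), one_div_mul_cancel hε.ne', Real.rpow_one] at h2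
      linarith
  have hsmall : ∏ q ∈ n.primeFactors, (if q < y then (2 : ℝ) else 1) ≤ 2 ^ y := by
    rw [Finset.prod_ite, Finset.prod_const, Finset.prod_const_one, mul_one]
    refine pow_le_pow_right₀ (by norm_num) ?_
    refine (Finset.card_le_card (t := Finset.range y) fun q hq => ?_).trans
      (Finset.card_range y).le
    exact Finset.mem_range.2 (Finset.mem_filter.1 hq).2
  have hrad : ∏ q ∈ n.primeFactors, (q : ℝ) ^ ε ≤ (n : ℝ) ^ ε := by
    rw [Real.finsetProd_rpow _ _ (fun q _ => Nat.cast_nonneg q)]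
    refine Real.rpow_le_rpow (Finset.prod_nonneg fun q _ => Nat.cast_nonneg q) ?_ hε.le
    rw [← Nat.cast_prod]
    exact Nat.cast_le.2 (Nat.le_of_dvd (Nat.pos_of_ne_zero hn) (Nat.prod_primeFactors_dvd n))
  calc (2 : ℝ) ^ n.primeFactors.card = ∏ q ∈ n.primeFactors, (2 : ℝ) := by simp
    _ ≤ ∏ q ∈ n.primeFactors, ((if q < y then 2 else 1) * (q : ℝ) ^ ε) :=
      Finset.prod_le_prod (fun _ _ => by norm_num) hterm
    _ = (∏ q ∈ n.primeFactors, (if q < y then (2 : ℝ) else 1)) *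
        ∏ q ∈ n.primeFactors, (q : ℝ) ^ ε := Finset.prod_mul_distrib
    _ ≤ _ := mul_le_mul hsmall hrad (Finset.prod_nonneg fun q _ => by positivity) (by positivity)

theorem exists_sum_abs_moebius_le {ε : ℝ} (hε : 0 < ε) :
    ∃ C : ℝ, 0 < C ∧ ∀ n : ℕ, n ≠ 0 →
      ∑ d ∈ n.divisors, |(ArithmeticFunction.moebius d : ℝ)| ≤ C * (n : ℝ) ^ ε := by
  obtain ⟨C, hC, h⟩ := exists_two_pow_card_primeFactors_le hε
  refine ⟨C, hC, fun n hn => le_trans ?_ (h n hn)⟩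
  have habs : ∀ d, |(ArithmeticFunction.moebius d : ℝ)| = if Squarefree d then (1 : ℝ) else 0 := by
    intro d
    have := ArithmeticFunction.abs_moebius (n := d)
    have h2 : ((|ArithmeticFunction.moebius d| : ℤ) : ℝ) =
        ((if Squarefree d then 1 else 0 : ℤ) : ℝ) := by rw [this]
    rw [← Int.cast_abs, h2]
    split_ifs <;> simp
  rw [Finset.sum_congr rfl fun d _ => habs d, Finset.sum_boole]
  exact_mod_cast card_squarefree_divisors_le hn

end SquarefreeDivisors

section PrimitiveRoots

variable {p : ℕ} [Fact p.Prime]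

theorem sum_moebius_mul_ite_pow_eq_one {x : ZMod p} (hx : x ≠ 0) :
    ∑ d ∈ (p - 1).divisors, ArithmeticFunction.moebius d *
      (if x ^ ((p - 1) / d) = 1 then 1 else 0) = if orderOf x = p - 1 then 1 else 0 := by
  have hp := (Fact.out : p.Prime).two_le
  have hdvd : orderOf x ∣ p - 1 := orderOf_dvd_of_pow_eq_one (ZMod.pow_card_sub_one_eq_one hx)
  obtain ⟨c, hc⟩ := hdvd
  have hm : p - 1 ≠ 0 := by omega
  have ho : orderOf x ≠ 0 := by rintro h; rw [h, zero_mul] at hc; exact hm hc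
  have hc0 : c ≠ 0 := by rintro rfl; exact hm (by simpa using hc)
  have hfilter : (p - 1).divisors.filter (fun d => x ^ ((p - 1) / d) = 1) = c.divisors := by
    ext d
    rw [Finset.mem_filter, Nat.mem_divisors, Nat.mem_divisors, ← orderOf_dvd_iff_pow_eq_one]
    constructor
    · rintro ⟨⟨⟨e, he⟩, _⟩, h⟩
      have hd : 0 < d := by
        rcases Nat.eq_zero_or_pos d with rfl | h
        · exact absurd (by simpa using he) hm
        · exact h
      rw [he, Nat.mul_div_cancel_left _ hd] at h
      obtain ⟨f, rfl⟩ := h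
      refine ⟨⟨f, ?_⟩, hc0⟩
      apply Nat.eq_of_mul_eq_mul_left (Nat.pos_of_ne_zero ho)
      rw [← hc, he]
      ring
    · rintro ⟨⟨f, rfl⟩, _⟩
      have hd : 0 < d := by
        rcases Nat.eq_zero_or_pos d with rfl | h
        · simp at hc0
        · exact h
      refine ⟨⟨⟨orderOf x * f, by rw [hc]; ring⟩, hm⟩, ?_⟩
      rw [hc, mul_left_comm, Nat.mul_div_cancel_left _ hd]
      exact Dvd.intro _ rfl
  have h := congrArg (fun f => f c) ArithmeticFunction.moebius_mul_coe_zeta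
  simp only [ArithmeticFunction.coe_mul_zeta_apply, ArithmeticFunction.one_apply] at h
  simp only [mul_ite, mul_one, mul_zero]
  rw [← Finset.sum_filter, hfilter, h]
  congr 1
  rw [eq_iff_iff, hc]
  constructor
  · rintro rfl; simp
  · intro h
    exact (Nat.eq_of_mul_eq_mul_left (Nat.pos_of_ne_zero ho) (by rw [mul_one]; exact h)).symm

/-- Detecting primitive roots by characters. -/
theorem natCast_mul_card_orderOf_eq {ι : Type*} (I : Finset ι) (a : ι → ZMod p)
    (ha : ∀ i ∈ I, a i ≠ 0) :
    ((p - 1 : ℕ) : ℂ) * (I.filter fun i => orderOf (a i) = p - 1).card =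
      ∑ d ∈ (p - 1).divisors, (ArithmeticFunction.moebius d : ℂ) *
        ∑ χ : DirichletCharacter ℂ p, ∑ i ∈ I, (χ ^ ((p - 1) / d)) (a i) := by
  have hp := (Fact.out : p.Prime).two_le
  have hchar : ∀ d ∈ (p - 1).divisors, ∀ i, ∑ χ : DirichletCharacter ℂ p,
      (χ ^ ((p - 1) / d)) (a i) =
        ((p - 1 : ℕ) : ℂ) * (if a i ^ ((p - 1) / d) = 1 then 1 else 0) := by
    intro d hd i
    have hd' := Nat.dvd_of_mem_divisors hd
    have he : (p - 1) / d ≠ 0 :=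
      (Nat.div_pos (Nat.le_of_dvd (by omega) hd') (Nat.pos_of_mem_divisors hd)).ne'
    simp only [MulChar.pow_apply' _ he, ← map_pow]
    rw [DirichletCharacter.sum_characters_eq, Nat.totient_prime Fact.out]
    simp
  have hI : ((I.filter fun i => orderOf (a i) = p - 1).card : ℂ) =
      ∑ i ∈ I, ∑ d ∈ (p - 1).divisors, (ArithmeticFunction.moebius d : ℂ) *
        (if a i ^ ((p - 1) / d) = 1 then 1 else 0) := by
    rw [← Finset.sum_boole]
    refine Finset.sum_congr rfl fun i hi => ?_
    have := congrArg (Int.cast : ℤ → ℂ) (sum_moebius_mul_ite_pow_eq_one (ha i hi))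
    push_cast at this
    exact this.symm
  rw [hI, Finset.sum_comm, Finset.mul_sum]
  refine Finset.sum_congr rfl fun d hd => ?_
  rw [Finset.sum_comm, Finset.sum_congr rfl fun i _ => hchar d hd i, ← Finset.mul_sum,
    ← Finset.mul_sum]
  ring

theorem sum_units_mulChar (χ : MulChar (ZMod p) ℂ) [Decidable (χ = 1)] :
    ∑ u : (ZMod p)ˣ, χ u = if χ = 1 then ((p - 1 : ℕ) : ℂ) else 0 := by
  split_ifs with h
  · subst h
    simp [ZMod.card_units p]
  · obtain ⟨a, ha⟩ := MulChar.ne_one_iff.1 h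
    refine eq_zero_of_mul_eq_self_left ha ?_
    simp only [Finset.mul_sum, ← map_mul, ← Units.val_mul]
    exact Fintype.sum_bijective _ (Group.mulLeft_bijective a) _ _ fun _ => rfl

open Classical in
theorem totient_eq_sum_moebius_mul_card :
    (Nat.totient (p - 1) : ℂ) = ∑ d ∈ (p - 1).divisors, (ArithmeticFunction.moebius d : ℂ) *
      ∑ χ : DirichletCharacter ℂ p, if χ ^ ((p - 1) / d) = 1 then (1 : ℂ) else 0 := by
  have hp := (Fact.out : p.Prime).two_le
  have h := natCast_mul_card_orderOf_eq (p := p) Finset.univ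
    (fun u : (ZMod p)ˣ => (u : ZMod p)) fun u _ => u.ne_zero
  have hcard : (Finset.univ.filter fun u : (ZMod p)ˣ => orderOf (u : ZMod p) = p - 1).card =
      Nat.totient (p - 1) := by
    simp only [orderOf_units]
    exact IsCyclic.card_orderOf_eq_totient (by rw [ZMod.card_units])
  rw [hcard] at h
  have hm : ((p - 1 : ℕ) : ℂ) ≠ 0 := Nat.cast_ne_zero.2 (by omega)
  apply mul_left_cancel₀ hm
  rw [h, Finset.mul_sum]
  refine Finset.sum_congr rfl fun d _ => ?_
  rw [Finset.sum_congr rfl fun χ _ => sum_units_mulChar (χ ^ ((p - 1) / d)), mul_left_comm]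
  congr 1
  rw [Finset.mul_sum]
  exact Finset.sum_congr rfl fun χ _ => by rw [mul_ite, mul_one, mul_zero]

theorem abs_card_orderOf_sub_le {ι : Type*} (I : Finset ι) (a : ι → ZMod p)
    (ha : ∀ i ∈ I, a i ≠ 0) {B : ℝ} (hB : 0 ≤ B)
    (h : ∀ χ : DirichletCharacter ℂ p, χ ≠ 1 → ‖∑ i ∈ I, χ (a i)‖ ≤ B) :
    |((I.filter fun i => orderOf (a i) = p - 1).card : ℝ) -
        I.card * (Nat.totient (p - 1) : ℝ) / ((p : ℝ) - 1)| ≤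
      (∑ d ∈ (p - 1).divisors, |(ArithmeticFunction.moebius d : ℝ)|) * B := by
  classical
  have hp := (Fact.out : p.Prime).two_le
  have hmR : ((p - 1 : ℕ) : ℝ) = (p : ℝ) - 1 := by rw [Nat.cast_sub (by omega)]; simp
  have hm0 : (0 : ℝ) < ((p - 1 : ℕ) : ℝ) := by exact_mod_cast (by omega : 0 < p - 1)
  rw [← hmR]
  set m := p - 1 with hm
  set Q := (I.filter fun i => orderOf (a i) = m).card with hQ
  have hchar : Fintype.card (DirichletCharacter ℂ p) = m := by
    rw [← Nat.card_eq_fintype_card, DirichletCharacter.card_eq_totient_of_hasEnoughRootsOfUnity,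
      Nat.totient_prime Fact.out]
  have heq : (m : ℂ) * Q - I.card * Nat.totient m =
      ∑ d ∈ m.divisors, (ArithmeticFunction.moebius d : ℂ) *
        ∑ χ : DirichletCharacter ℂ p, (∑ i ∈ I, (χ ^ (m / d)) (a i) -
          I.card * if χ ^ (m / d) = 1 then (1 : ℂ) else 0) := by
    rw [hQ, natCast_mul_card_orderOf_eq I a ha, totient_eq_sum_moebius_mul_card, Finset.mul_sum,
      ← Finset.sum_sub_distrib]
    refine Finset.sum_congr rfl fun d _ => ?_
    rw [Finset.sum_sub_distrib, ← Finset.mul_sum]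
    ring
  have hterm : ∀ χ : DirichletCharacter ℂ p,
      ‖∑ i ∈ I, χ (a i) - I.card * if χ = 1 then (1 : ℂ) else 0‖ ≤ B := by
    intro χ
    split_ifs with h1
    · subst h1
      rw [Finset.sum_congr rfl fun i hi => MulChar.one_apply (IsUnit.mk0 _ (ha i hi))]
      simpa using hB
    · simpa using h χ h1
  have hnorm : ‖(m : ℂ) * Q - I.card * Nat.totient m‖ ≤
      m * ((∑ d ∈ m.divisors, |(ArithmeticFunction.moebius d : ℝ)|) * B) := by
    rw [heq, Finset.sum_mul, Finset.mul_sum]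
    refine (norm_sum_le _ _).trans (Finset.sum_le_sum fun d _ => ?_)
    rw [norm_mul, Complex.norm_intCast, mul_left_comm]
    refine mul_le_mul_of_nonneg_left ?_ (abs_nonneg _)
    refine (norm_sum_le _ _).trans ((Finset.sum_le_sum fun χ _ => hterm _).trans (le_of_eq ?_))
    rw [Finset.sum_const, Finset.card_univ, hchar, nsmul_eq_mul]
  have hreal : ‖(m : ℂ) * Q - I.card * Nat.totient m‖ =
      m * |(Q : ℝ) - I.card * Nat.totient m / m| := by
    have : (m : ℂ) * Q - I.card * Nat.totient m =
        ((m * ((Q : ℝ) - I.card * Nat.totient m / m) : ℝ) : ℂ) := by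
      rw [mul_sub, mul_div_cancel₀ _ hm0.ne']
      push_cast
      ring
    rw [this, Complex.norm_real, norm_mul, Real.norm_of_nonneg hm0.le, Real.norm_eq_abs]
  rw [hreal] at hnorm
  exact le_of_mul_le_mul_left hnorm hm0

end PrimitiveRoots

end WeilAndFactorials

/-- Corollary (primitive roots among factorials, counting version): for every
`ε > 0` there is `C = C(ε) > 0` such that for every odd prime `p` and all
`0 ≤ H < H + N < p`, the number `Q(H,N)` of `n ∈ {H+1, …, H+N}` with `n!` a
primitive root mod `p` satisfies
`|Q(H,N) - N φ(p-1)/(p-1)| ≤ C N^{3/4} p^{1/8+ε}`. -/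
theorem count_factorial_primitive_roots (ε : ℝ) (hε : 0 < ε) :
    ∃ C : ℝ, 0 < C ∧ ∀ p : ℕ, p.Prime → Odd p →
      ∀ H N : ℕ, 0 < N → H + N < p →
        |({n : ℕ | n ∈ Finset.Icc (H + 1) (H + N) ∧
              orderOf ((n.factorial : ZMod p)) = p - 1}.ncard : ℝ) -
            (N : ℝ) * (Nat.totient (p - 1) : ℝ) / ((p : ℝ) - 1)| ≤
          C * (N : ℝ) ^ ((3 : ℝ) / 4) * (p : ℝ) ^ ((1 : ℝ) / 8 + ε) := by
  obtain ⟨C, hC, hdiv⟩ := exists_sum_abs_moebius_le hε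
  refine ⟨7 * C, by positivity, fun p hp hodd H N hN hHN => ?_⟩
  have _ : Fact p.Prime := ⟨hp⟩
  have hp3 : 3 ≤ p := by
    have := hp.two_le
    rcases hodd with ⟨r, rfl⟩
    omega
  have hp0 : (0 : ℝ) < p := by exact_mod_cast hp.pos
  have hset : {n : ℕ | n ∈ Finset.Icc (H + 1) (H + N) ∧
      orderOf ((n.factorial : ZMod p)) = p - 1} =
      ((Finset.Icc (H + 1) (H + N)).filter fun n => orderOf ((n.factorial : ZMod p)) = p - 1 :
        Finset ℕ) := by
    ext n
    simp
  rw [hset, Set.ncard_coe_finset]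
  have hne : ∀ n ∈ Finset.Icc (H + 1) (H + N), (n.factorial : ZMod p) ≠ 0 := by
    intro n hn
    rw [Ne, ZMod.natCast_eq_zero_iff, hp.dvd_factorial]
    have := (Finset.mem_Icc.1 hn).2
    omega
  have hB : 0 ≤ 7 * ((N : ℝ) ^ ((3 : ℝ) / 4) * (p : ℝ) ^ ((1 : ℝ) / 8)) := by positivity
  have hmain := abs_card_orderOf_sub_le (Finset.Icc (H + 1) (H + N))
    (fun n => (n.factorial : ZMod p)) hne hB fun χ hχ => norm_sum_factorial_le hp3 hχ hN hHN
  rw [Nat.card_Icc, (by omega : H + N + 1 - (H + 1) = N)] at hmain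
  refine hmain.trans ?_
  have hd := (hdiv (p - 1) (by omega)).trans (mul_le_mul_of_nonneg_left
    (Real.rpow_le_rpow (Nat.cast_nonneg _) (Nat.cast_le.2 (Nat.sub_le p 1)) hε.le) hC.le)
  refine (mul_le_mul_of_nonneg_right hd hB).trans (le_of_eq ?_)
  rw [Real.rpow_add hp0]
  ring
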